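/- Let (X, ℝ, α) be a one-parameter C*-dynamical system such that 0 is an accumulation point of sp(α) and X^α([0,∞)) is a maximal norm-closed subalgebra of X. Then Condition 4.3 b) holds: there exists a norm-closed α-invariant α-simple two-sided ideal Y of X such that Y^α((0,∞)) = X^α((0,∞)), sp(α|_Y) = Γ̃(α|_Y), and Y + X^α([0,∞)) is norm-dense in X. -/

import Mathlib

open MeasureTheory Set Filter Topology Pointwise

noncomputable section

namespace PeligradMax

variable {X : Type*} [NonUnitalNormedRing X] [StarRing X] [CStarRing X]
  [NormedSpace ℂ X] [IsScalarTower ℂ X X] [SMulCommClass ℂ X X] [StarModule ℂ X]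
  [CompleteSpace X] [PartialOrder X] [StarOrderedRing X]

/-- A one-parameter C*-dynamical system: a group of *-automorphisms of `X`
with norm-continuous orbit maps. -/
structure IsCStarDynSys (α : ℝ → X → X) : Prop where
  map_zero_time : ∀ x, α 0 x = x
  map_add_time : ∀ s t x, α (s + t) x = α s (α t x)
  map_add : ∀ t x y, α t (x + y) = α t x + α t y
  map_smulc : ∀ (t : ℝ) (c : ℂ) (x : X), α t (c • x) = c • α t x
  map_mul : ∀ t x y, α t (x * y) = α t x * α t y
  map_star : ∀ t x, α t (star x) = star (α t x)
  continuous_orbit : ∀ x, Continuous fun t => α t x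

/-- Closed linear span. -/
def ClosedSpan (S : Set X) : Set X := closure ((Submodule.span ℂ S : Submodule ℂ X) : Set X)

def MulSet2 (S T : Set X) : Set X := {z | ∃ s ∈ S, ∃ t ∈ T, z = s * t}

def MulSet3 (S T R : Set X) : Set X := {z | ∃ s ∈ S, ∃ t ∈ T, ∃ r ∈ R, z = s * t * r}

/-- Fourier transform of an integrable function. -/
def fourierT (f : ℝ → ℂ) (γ : ℝ) : ℂ := ∫ t : ℝ, f t * Complex.exp (-(Complex.I * γ * t))

/-- `α_f(x) = ∫ f(t) α_t(x) dt`. -/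
def smear (α : ℝ → X → X) (f : ℝ → ℂ) (x : X) : X := ∫ t : ℝ, f t • α t x

/-- Arveson spectrum of an element. -/
def elemSpec (α : ℝ → X → X) (x : X) : Set ℝ :=
  {γ | ∀ f : ℝ → ℂ, Integrable f → smear α f x = 0 → fourierT f γ = 0}

/-- Spectral subspace associated with a closed set `F ⊆ ℝ`. -/
def specC (α : ℝ → X → X) (F : Set ℝ) : Set X := {x | elemSpec α x ⊆ F}

/-- Spectral subspace of the subset `S` associated with an open set `U ⊆ ℝ`. -/
def specO (α : ℝ → X → X) (S : Set X) (U : Set ℝ) : Set X :=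
  ClosedSpan {y | ∃ x ∈ S, ∃ f : ℝ → ℂ, Integrable f ∧
    IsCompact (tsupport (fourierT f)) ∧ tsupport (fourierT f) ⊆ U ∧ y = smear α f x}

/-- The fixed point algebra `X^α`. -/
def fixedPts (α : ℝ → X → X) : Set X := {x | ∀ t, α t x = x}

/-- The Arveson spectrum of the action restricted to `S`. -/
def actSpec (α : ℝ → X → X) (S : Set X) : Set ℝ :=
  {γ : ℝ | ∀ ε > (0 : ℝ), S ∩ specC α (Icc (γ - ε) (γ + ε)) ≠ ({0} : Set X)}

def Invariant (α : ℝ → X → X) (S : Set X) : Prop := ∀ t : ℝ, ∀ x ∈ S, α t x ∈ S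

def IsSubalgebra (B : Set X) : Prop :=
  (0 : X) ∈ B ∧ (∀ x ∈ B, ∀ y ∈ B, x + y ∈ B) ∧
  (∀ c : ℂ, ∀ x ∈ B, c • x ∈ B) ∧ ∀ x ∈ B, ∀ y ∈ B, x * y ∈ B

def IsStarSubalgebra (B : Set X) : Prop := IsSubalgebra B ∧ ∀ x ∈ B, star x ∈ B

/-- `B` is a hereditary C*-subalgebra of the subset `S`. -/
def IsHereditaryIn (S B : Set X) : Prop :=
  B ⊆ S ∧ IsClosed B ∧ IsStarSubalgebra B ∧
  ∀ x ∈ S, ∀ b ∈ B, 0 ≤ x → x ≤ b → x ∈ B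

/-- `K` is a norm-closed two-sided ideal of the subset `S`. -/
def IsClosedTwoSidedIdealIn (S K : Set X) : Prop :=
  K ⊆ S ∧ IsClosed K ∧ (0 : X) ∈ K ∧ (∀ x ∈ K, ∀ y ∈ K, x + y ∈ K) ∧
  (∀ c : ℂ, ∀ x ∈ K, c • x ∈ K) ∧ ∀ s ∈ S, ∀ k ∈ K, s * k ∈ K ∧ k * s ∈ K

/-- `S` is `α`-simple: no nontrivial norm-closed `α`-invariant two-sided ideals. -/
def AlphaSimple (α : ℝ → X → X) (S : Set X) : Prop :=
  ∀ K : Set X, IsClosedTwoSidedIdealIn S K → Invariant α K → K = ({0} : Set X) ∨ K = S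

/-- The strong Arveson spectrum of the action restricted to `B`. -/
def strongSpec (α : ℝ → X → X) (B : Set X) : Set ℝ :=
  {γ : ℝ | ∀ ε > (0 : ℝ),
    ClosedSpan (MulSet3 (star '' (B ∩ specC α (Icc (γ - ε) (γ + ε)))) B
      (B ∩ specC α (Icc (γ - ε) (γ + ε)))) = B}

/-- The strong Connes spectrum of the action restricted to `S`. -/
def ConnesSpec (α : ℝ → X → X) (S : Set X) : Set ℝ :=
  ⋂ B ∈ {B : Set X | IsHereditaryIn S B ∧ B ≠ ({0} : Set X) ∧ Invariant α B},
    strongSpec α B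

def IsMaximalClosedSubalgebra (B : Set X) : Prop :=
  IsClosed B ∧ IsSubalgebra B ∧ B ≠ (univ : Set X) ∧
  ∀ W : Set X, IsClosed W → IsSubalgebra W → B ⊆ W → W = B ∨ W = univ

/-- The spectral Condition 4.3. -/
def Condition43 (α : ℝ → X → X) : Prop :=
  (∃ γ₀ : ℝ, 0 < γ₀ ∧ actSpec α (univ : Set X) = ({-γ₀, 0, γ₀} : Set ℝ) ∧
    IsClosedTwoSidedIdealIn (fixedPts α)
      (ClosedSpan (MulSet2 (specC α ({γ₀} : Set ℝ)) (star '' specC α ({γ₀} : Set ℝ)))) ∧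
    ∀ K : Set X,
      IsClosedTwoSidedIdealIn
        (ClosedSpan (MulSet2 (specC α ({γ₀} : Set ℝ)) (star '' specC α ({γ₀} : Set ℝ)))) K →
      K = ({0} : Set X) ∨
        K = ClosedSpan (MulSet2 (specC α ({γ₀} : Set ℝ)) (star '' specC α ({γ₀} : Set ℝ)))) ∨
  (∃ Y : Set X, IsClosedTwoSidedIdealIn (univ : Set X) Y ∧ Invariant α Y ∧ AlphaSimple α Y ∧
    specO α Y (Ioi (0 : ℝ)) = specO α (univ : Set X) (Ioi (0 : ℝ)) ∧
    actSpec α Y = ConnesSpec α Y ∧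
    closure (Y + specC α (Ici (0 : ℝ))) = (univ : Set X))

set_option linter.unusedSectionVars false

section

namespace IsCStarDynSys

variable {α : ℝ → X → X}

lemma inverse_apply (hα : IsCStarDynSys α) (t : ℝ) (x : X) : α (-t) (α t x) = x := by
  rw [← hα.map_add_time, neg_add_cancel, hα.map_zero_time]

lemma apply_zero (hα : IsCStarDynSys α) (t : ℝ) : α t 0 = 0 := by
  simpa using hα.map_smulc t 0 0

lemma norm_apply (hα : IsCStarDynSys α) (t : ℝ) (x : X) : ‖α t x‖ = ‖x‖ := by
  let _ : NonUnitalCStarAlgebra X := { }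
  let φ : X →⋆ₙₐ[ℂ] X :=
    { toFun := α t
      map_smul' := hα.map_smulc t
      map_zero' := hα.apply_zero t
      map_add' := hα.map_add t
      map_mul' := hα.map_mul t
      map_star' := hα.map_star t }
  exact NonUnitalStarAlgHom.norm_map φ (Function.LeftInverse.injective (hα.inverse_apply t)) x

/-- The time-`t` automorphism as a continuous linear map. -/
def clm (hα : IsCStarDynSys α) (t : ℝ) : X →L[ℂ] X :=
  LinearMap.mkContinuous
    { toFun := α t, map_add' := hα.map_add t, map_smul' := hα.map_smulc t } 1
    (fun x => by simpa using (hα.norm_apply t x).le)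

@[simp] lemma clm_apply (hα : IsCStarDynSys α) (t : ℝ) (x : X) : hα.clm t x = α t x := rfl

lemma integrable_smul (hα : IsCStarDynSys α) {f : ℝ → ℂ} (hf : Integrable f) (x : X) :
    Integrable fun t => f t • α t x := by
  refine (hf.norm.mul_const ‖x‖).mono'
    (hf.aestronglyMeasurable.smul (hα.continuous_orbit x).aestronglyMeasurable) ?_
  filter_upwards with t
  rw [norm_smul, hα.norm_apply]

lemma norm_smear_le (hα : IsCStarDynSys α) (f : ℝ → ℂ) (x : X) :
    ‖smear α f x‖ ≤ (∫ t, ‖f t‖) * ‖x‖ := by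
  unfold smear
  refine (norm_integral_le_integral_norm _).trans_eq ?_
  simp_rw [norm_smul, hα.norm_apply, integral_mul_const]

/-- Smearing by an integrable function as a continuous linear map. -/
def smearL (hα : IsCStarDynSys α) {f : ℝ → ℂ} (hf : Integrable f) : X →L[ℂ] X :=
  LinearMap.mkContinuous
    { toFun := smear α f
      map_add' := fun x y => by
        simp only [smear, hα.map_add, smul_add]
        exact integral_add (hα.integrable_smul hf x) (hα.integrable_smul hf y)
      map_smul' := fun c x => by
        simp only [smear, hα.map_smulc, RingHom.id_apply]
        rw [← integral_smul]
        exact integral_congr_ae (ae_of_all _ fun t => smul_comm _ _ _) }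
    (∫ t, ‖f t‖) (hα.norm_smear_le f)

@[simp] lemma smearL_apply (hα : IsCStarDynSys α) {f : ℝ → ℂ} (hf : Integrable f) (x : X) :
    hα.smearL hf x = smear α f x := rfl

lemma smear_add_fun (hα : IsCStarDynSys α) {f g : ℝ → ℂ} (hf : Integrable f) (hg : Integrable g)
    (x : X) : smear α (fun t => f t + g t) x = smear α f x + smear α g x := by
  simp only [smear, add_smul]
  exact integral_add (hα.integrable_smul hf x) (hα.integrable_smul hg x)

lemma apply_smear (hα : IsCStarDynSys α) {f : ℝ → ℂ} (hf : Integrable f) (s : ℝ) (x : X) :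
    α s (smear α f x) = smear α f (α s x) := by
  have h := (hα.clm s).integral_comp_comm (hα.integrable_smul hf x)
  simp only [clm_apply, hα.map_smulc, ← hα.map_add_time] at h
  simp only [smear, ← hα.map_add_time]
  rw [← h]
  simp only [add_comm]

lemma smear_comm (hα : IsCStarDynSys α) {f k : ℝ → ℂ} (hf : Integrable f) (hk : Integrable k)
    (x : X) : smear α f (smear α k x) = smear α k (smear α f x) := by
  have h := (hα.smearL hf).integral_comp_comm (hα.integrable_smul hk x)
  have h2 : smear α k (smear α f x) = ∫ t, hα.smearL hf (k t • α t x) := by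
    simp only [map_smul, smearL_apply, ← hα.apply_smear hf]; rfl
  rw [h2, h]; rfl

end IsCStarDynSys

/-! ### Smooth compactly supported symbols and their kernels -/

/-- Smooth compactly supported symbols. -/
structure Nice (g : ℝ → ℂ) : Prop where
  smooth : ContDiff ℝ (⊤ : ℕ∞) g
  cpt : HasCompactSupport g

/-- The kernel whose Fourier transform is `g`. -/
def kern (g : ℝ → ℂ) (u : ℝ) : ℂ :=
  ((2 * Real.pi)⁻¹ : ℝ) • ∫ ξ : ℝ, g ξ * Complex.exp (Complex.I * ξ * u)

namespace Nice

variable {g h : ℝ → ℂ}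

lemma integrable (hg : Nice g) : Integrable g :=
  hg.smooth.continuous.integrable_of_hasCompactSupport hg.cpt

lemma mul_right (hg : Nice g) (hh : ContDiff ℝ (⊤ : ℕ∞) h) : Nice (fun t => g t * h t) :=
  ⟨hg.smooth.mul hh, hg.cpt.mul_right⟩

open scoped FourierTransform SchwartzMap

/-- The inverse Fourier transform of a nice symbol as a Schwartz function. -/
lemma exists_schwartz (hg : Nice g) : ∃ S : 𝓢(ℝ, ℂ),
    (∀ u, kern g u = ((2 * Real.pi)⁻¹ : ℝ) • S ((2 * Real.pi)⁻¹ * u)) ∧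
    𝓕 (S : ℝ → ℂ) = g := by
  refine ⟨𝓕⁻ (hg.cpt.toSchwartzMap hg.smooth), ?_, ?_⟩
  · intro u
    rw [SchwartzMap.fourierInv_coe, Real.fourierInv_eq']
    unfold kern
    congr 1
    refine integral_congr_ae (ae_of_all _ fun ξ => ?_)
    simp only [smul_eq_mul]
    rw [mul_comm]
    congr 2
    have : (Real.pi : ℂ) ≠ 0 := by exact_mod_cast Real.pi_ne_zero
    simp
    field_simp
  · rw [← SchwartzMap.fourier_coe, FourierTransform.fourier_fourierInv_eq]
    rfl

end Nice

end

section

open scoped FourierTransform SchwartzMap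

namespace Nice

variable {g h : ℝ → ℂ}

lemma continuous_kern (hg : Nice g) : Continuous (kern g) := by
  obtain ⟨S, hS, -⟩ := hg.exists_schwartz
  rw [funext hS]
  have := S.continuous
  fun_prop

lemma integrable_kern (hg : Nice g) : Integrable (kern g) := by
  obtain ⟨S, hS, -⟩ := hg.exists_schwartz
  rw [funext hS]
  exact ((S.integrable (μ := volume)).comp_mul_left' (inv_ne_zero Real.two_pi_pos.ne')).smul
    ((2 * Real.pi)⁻¹ : ℝ)

lemma fourierT_kern (hg : Nice g) : fourierT (kern g) = g := by
  obtain ⟨S, hS, hS'⟩ := hg.exists_schwartz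
  funext γ
  conv_rhs => rw [← hS', Real.fourier_real_eq_integral_exp_smul]
  have h := MeasureTheory.Measure.integral_comp_mul_left
    (fun v : ℝ => Complex.exp (↑(-2 * Real.pi * v * γ) * Complex.I) • S v) ((2 * Real.pi)⁻¹)
  have hp : (0:ℝ) < 2 * Real.pi := by positivity
  rw [inv_inv, abs_of_pos hp] at h
  have h2 : (∫ v : ℝ, Complex.exp (↑(-2 * Real.pi * v * γ) * Complex.I) • S v) =
      (2 * Real.pi)⁻¹ • ((2 * Real.pi) • ∫ v : ℝ, Complex.exp (↑(-2 * Real.pi * v * γ) * Complex.I) • S v) := by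
    rw [smul_smul, inv_mul_cancel₀ hp.ne', one_smul]
  rw [h2, ← h, ← integral_smul]
  unfold fourierT
  refine integral_congr_ae (ae_of_all _ fun t => ?_)
  simp only [hS, smul_eq_mul, Complex.real_smul]
  have : -(Complex.I * γ * t) = ↑(-2 * Real.pi * ((2 * Real.pi)⁻¹ * t) * γ) * Complex.I := by
    have : (Real.pi : ℂ) ≠ 0 := by exact_mod_cast Real.pi_ne_zero
    push_cast
    field_simp
  rw [this]; ring

lemma decay_kern (hg : Nice g) : ∃ C, 0 ≤ C ∧ ∀ u, ‖kern g u‖ ≤ C * (1 + u ^ 2)⁻¹ := by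
  obtain ⟨S, hS, -⟩ := hg.exists_schwartz
  obtain ⟨C₀, hC₀⟩ := S.decay 0 0
  obtain ⟨C₂, hC₂⟩ := S.decay 2 0
  have hp : (0:ℝ) < (2 * Real.pi)⁻¹ := by positivity
  set a := (2 * Real.pi)⁻¹ with ha
  have h0 : ∀ u, ‖S u‖ ≤ C₀ := fun u => by simpa using hC₀.2 u
  have h2 : ∀ u : ℝ, u ^ 2 * ‖S u‖ ≤ C₂ := fun u => by simpa using hC₂.2 u
  refine ⟨a * (C₀ + C₂ / a ^ 2), by have := hC₀.1; have := hC₂.1; positivity, fun u => ?_⟩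
  rw [hS, norm_smul, Real.norm_eq_abs, abs_of_pos hp, mul_assoc]
  refine mul_le_mul_of_nonneg_left ?_ hp.le
  rw [← div_eq_mul_inv, le_div_iff₀ (by positivity), mul_comm, add_mul, one_mul]
  refine add_le_add (h0 _) ?_
  rw [le_div_iff₀ (by positivity)]
  have := h2 (a * u)
  nlinarith

/-- Rescaling a symbol. -/
lemma kern_comp_div (g : ℝ → ℂ) {r : ℝ} (hr : 0 < r) (γ u : ℝ) :
    kern (fun ξ => g ((ξ - γ) / r)) u =
      r • (Complex.exp (Complex.I * γ * u) * kern g (r * u)) := by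
  unfold kern
  have h1 := integral_sub_right_eq_self (μ := volume)
    (fun ξ : ℝ => g (ξ / r) * Complex.exp (Complex.I * (ξ + γ : ℝ) * u)) γ
  have h2 := MeasureTheory.Measure.integral_comp_div
    (fun ξ : ℝ => g ξ * Complex.exp (Complex.I * (r * ξ + γ : ℝ) * u)) r
  simp only [sub_add_cancel] at h1
  rw [h1]
  have h3 : ∀ ξ : ℝ, r * (ξ / r) = ξ := fun ξ => by field_simp
  simp only [h3] at h2
  rw [h2, abs_of_pos hr, smul_comm]
  congr 1
  rw [mul_smul_comm, ← integral_const_mul]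
  congr 1
  refine integral_congr_ae (ae_of_all _ fun ξ => ?_)
  simp only
  have : Complex.I * (r * ξ + γ : ℝ) * u = Complex.I * γ * u + Complex.I * ξ * (r * u : ℝ) := by
    push_cast; ring
  rw [this, Complex.exp_add]; ring

lemma comp_div (hg : Nice g) {r : ℝ} (hr : 0 < r) (γ : ℝ) : Nice (fun ξ => g ((ξ - γ) / r)) := by
  refine ⟨hg.smooth.comp (by fun_prop), ?_⟩
  have := hg.cpt.comp_homeomorph ((Homeomorph.subRight γ).trans (Homeomorph.mulRight₀ r⁻¹ (by positivity)))
  simpa [Function.comp_def, div_eq_mul_inv] using this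

end Nice

/-- Smooth symbols equal to one on `[-1, 1]` and vanishing off `[-2, 2]`. -/
lemma exists_bump : ∃ g : ℝ → ℂ, Nice g ∧ (∀ ξ, |ξ| ≤ 1 → g ξ = 1) ∧ (∀ ξ, 2 ≤ |ξ| → g ξ = 0) := by
  let f : ContDiffBump (0:ℝ) := ⟨1, 2, by norm_num, by norm_num⟩
  refine ⟨fun x => (f x : ℂ), ⟨?_, ?_⟩, ?_, ?_⟩
  · exact Complex.ofRealCLM.contDiff.comp f.contDiff
  · exact f.hasCompactSupport.comp_left (g := fun x : ℝ => (x : ℂ)) (by simp)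
  · intro ξ h
    have := f.one_of_mem_closedBall (x := ξ) (by simpa [Metric.mem_closedBall, dist_eq_norm] using h)
    simp [this]
  · intro ξ h
    have := f.zero_of_le_dist (x := ξ) (by simpa [dist_eq_norm] using h)
    simp [this]

/-- Smooth steps: zero below `a`, one above `b`. -/
lemma exists_step {a b : ℝ} (hab : a < b) : ∃ χ : ℝ → ℂ, ContDiff ℝ (⊤ : ℕ∞) χ ∧
    (∀ ξ ≤ a, χ ξ = 0) ∧ ∀ ξ, b ≤ ξ → χ ξ = 1 := by
  refine ⟨fun x => (Real.smoothTransition ((x - a) / (b - a)) : ℂ), ?_, ?_, ?_⟩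
  · exact Complex.ofRealCLM.contDiff.comp (Real.smoothTransition.contDiff.comp (by fun_prop))
  · intro ξ h
    dsimp only
    rw [Real.smoothTransition.zero_of_nonpos]
    · simp
    · exact div_nonpos_of_nonpos_of_nonneg (by linarith) (by linarith)
  · intro ξ h
    dsimp only
    rw [Real.smoothTransition.one_of_one_le]
    · simp
    · rw [one_le_div (by linarith)]; linarith

lemma contDiff_one_sub {χ : ℝ → ℂ} (hχ : ContDiff ℝ (⊤ : ℕ∞) χ) :
    ContDiff ℝ (⊤ : ℕ∞) fun ξ => 1 - χ ξ := contDiff_const.sub hχ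

lemma kern_comp_neg (g : ℝ → ℂ) (u : ℝ) : kern (fun ξ => g (-ξ)) u = kern g (-u) := by
  unfold kern
  congr 1
  rw [← integral_neg_eq_self]
  simp

lemma Nice.comp_neg {g : ℝ → ℂ} (hg : Nice g) : Nice fun ξ => g (-ξ) :=
  ⟨hg.smooth.comp contDiff_neg, hg.cpt.comp_homeomorph (Homeomorph.neg ℝ)⟩

end

section

/-- The spectral multiplier with symbol `g`. -/
def mult (α : ℝ → X → X) (g : ℝ → ℂ) (x : X) : X := smear α (kern g) x

lemma integrable_smul_of_bound {E : Type*} [NormedAddCommGroup E] [NormedSpace ℂ E] {F : ℝ × ℝ → ℂ} (hF : Integrable F (volume.prod volume))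
    {v : ℝ × ℝ → E} (hv : Continuous v) {C : ℝ} (hC : ∀ p, ‖v p‖ ≤ C) :
    Integrable (fun p => F p • v p) (volume.prod volume) := by
  refine (hF.norm.mul_const C).mono' (hF.aestronglyMeasurable.smul hv.aestronglyMeasurable) ?_
  filter_upwards with p
  rw [norm_smul]
  exact mul_le_mul_of_nonneg_left (hC p) (norm_nonneg _)

/-- Convolving with the kernel of `g` multiplies the symbol by the Fourier transform. -/
lemma integral_mul_kern {f g : ℝ → ℂ} (hf : Integrable f) (hg : Nice g) (u : ℝ) :
    ∫ t, f t * kern g (u - t) = kern (fun ξ => g ξ * fourierT f ξ) u := by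
  have h1 : Integrable (fun p : ℝ × ℝ => (f p.1 * g p.2) * Complex.exp (Complex.I * p.2 * (u - p.1 : ℝ)))
      (volume.prod volume) := by
    have h : Integrable (fun p : ℝ × ℝ => f p.1 * g p.2) (volume.prod volume) :=
      hf.mul_prod hg.integrable
    have h' := integrable_smul_of_bound (E := ℂ) h
      (v := fun p => Complex.exp (Complex.I * p.2 * (u - p.1 : ℝ))) (by fun_prop) (C := 1) (by
        intro p
        rw [Complex.norm_exp]; simp)
    simpa using h'
  have h2 := integral_integral_swap (f := fun (t ξ : ℝ) =>
    (f t * g ξ) * Complex.exp (Complex.I * ξ * (u - t : ℝ))) h1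
  unfold kern fourierT
  simp only [mul_smul_comm, integral_smul, ← integral_const_mul, ← mul_assoc]
  rw [h2]
  congr 1
  refine integral_congr_ae (ae_of_all _ fun ξ => ?_)
  simp only
  rw [← integral_mul_const]
  refine integral_congr_ae (ae_of_all _ fun t => ?_)
  simp only
  have : Complex.I * ξ * (u - t : ℝ) = -(Complex.I * ξ * t) + Complex.I * ξ * u := by
    push_cast; ring
  rw [this, Complex.exp_add]; ring

namespace IsCStarDynSys

variable {α : ℝ → X → X}

lemma smear_mult (hα : IsCStarDynSys α) {f g : ℝ → ℂ} (hf : Integrable f) (hg : Nice g) (x : X) :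
    smear α f (mult α g x) = smear α (kern fun ξ => g ξ * fourierT f ξ) x := by
  have hk := hg.integrable_kern
  have h1 : Integrable (fun p : ℝ × ℝ => (f p.1 * kern g (p.2 - p.1)) • α p.2 x)
      (volume.prod volume) := by
    refine integrable_smul_of_bound ?_ ((hα.continuous_orbit x).comp continuous_snd) (C := ‖x‖)
      (fun p => (hα.norm_apply _ _).le)
    have := (hf.convolution_integrand (ContinuousLinearMap.mul ℝ ℂ) hk).swap
    exact this
  have h2 := integral_integral_swap (f := fun (t u : ℝ) => (f t * kern g (u - t)) • α u x) h1
  have h3 : ∀ u : ℝ, ∫ t, (f t * kern g (u - t)) • α u x =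
      (kern fun ξ => g ξ * fourierT f ξ) u • α u x := fun u => by
    rw [integral_smul_const, integral_mul_kern hf hg]
  simp only [h3] at h2
  change _ = ∫ u, (kern fun ξ => g ξ * fourierT f ξ) u • α u x
  rw [← h2]
  unfold smear mult
  refine integral_congr_ae (ae_of_all _ fun t => ?_)
  simp only [mul_smul, integral_smul]
  congr 1
  rw [hα.apply_smear hk]
  unfold smear
  rw [← integral_sub_right_eq_self _ t]
  refine integral_congr_ae (ae_of_all _ fun u => ?_)
  simp only [← hα.map_add_time, sub_add_cancel]

lemma mult_mult (hα : IsCStarDynSys α) {g h : ℝ → ℂ} (hg : Nice g) (hh : Nice h) (x : X) :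
    mult α h (mult α g x) = mult α (fun ξ => g ξ * h ξ) x := by
  conv_lhs => unfold mult
  change smear α (kern h) (mult α g x) = _
  rw [hα.smear_mult hh.integrable_kern hg, hh.fourierT_kern]
  rfl

lemma mult_add (hα : IsCStarDynSys α) {g h : ℝ → ℂ} (hg : Nice g) (hh : Nice h) (x : X) :
    mult α (fun ξ => g ξ + h ξ) x = mult α g x + mult α h x := by
  unfold mult
  rw [← hα.smear_add_fun hg.integrable_kern hh.integrable_kern]
  congr 1
  funext u
  unfold kern
  rw [← smul_add, ← integral_add]
  · simp only [add_mul]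
  all_goals
  · refine Integrable.mul_bdd (c := 1) (Nice.integrable ‹_›) (by fun_prop) (ae_of_all _ fun ξ => ?_)
    rw [Complex.norm_exp]; simp

lemma mult_zero_symbol (x : X) : mult α (fun _ => 0) x = 0 := by
  simp [mult, smear, kern]

lemma mult_eq_zero {g : ℝ → ℂ} (h : ∀ ξ, g ξ = 0) (x : X) : mult α g x = 0 := by
  rw [funext h]; exact mult_zero_symbol x

/-- Multipliers with symbols rescaled to be constant approximate the identity. -/
lemma tendsto_mult (hα : IsCStarDynSys α) {g : ℝ → ℂ} (hg : Nice g) (h1 : g 0 = 1) (x : X) :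
    Tendsto (fun n : ℕ => mult α (fun ξ => g ((ξ - 0) / (n + 1 : ℝ))) x) atTop (𝓝 x) := by
  have h_int : ∫ v, kern g v = 1 := by
    have := congrFun hg.fourierT_kern 0
    simpa [fourierT, h1] using this
  have e : ∀ n : ℕ, mult α (fun ξ => g ((ξ - 0) / (n + 1 : ℝ))) x =
      ∫ v, kern g v • α ((n + 1 : ℝ)⁻¹ * v) x := by
    intro n
    have hn : (0:ℝ) < n + 1 := by positivity
    have := MeasureTheory.Measure.integral_comp_mul_left
      (fun v : ℝ => kern g v • α ((n + 1 : ℝ)⁻¹ * v) x) (n + 1)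
    rw [abs_of_pos (inv_pos.2 hn), eq_inv_smul_iff₀ hn.ne', ← integral_smul] at this
    rw [← this]
    unfold mult smear
    refine integral_congr_ae (ae_of_all _ fun u => ?_)
    simp only [Nice.kern_comp_div g hn]
    rw [inv_mul_cancel_left₀ hn.ne']
    simp only [Complex.ofReal_zero, mul_zero, zero_mul, Complex.exp_zero, one_mul]
    exact smul_assoc _ _ _
  simp only [e]
  have h2 : x = ∫ v, kern g v • x := by rw [integral_smul_const, h_int, one_smul]
  conv => enter [3]; rw [h2]
  refine tendsto_integral_of_dominated_convergence (fun v => ‖kern g v‖ * ‖x‖) ?_ ?_ ?_ ?_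
  · intro n
    exact hg.integrable_kern.aestronglyMeasurable.smul
      ((hα.continuous_orbit x).comp (continuous_const.mul continuous_id)).aestronglyMeasurable
  · exact hg.integrable_kern.norm.mul_const _
  · intro n
    filter_upwards with v
    rw [norm_smul, hα.norm_apply]
  · filter_upwards with v
    have h3 : Tendsto (fun n : ℕ => (n + 1 : ℝ)⁻¹ * v) atTop (𝓝 0) := by
      have := tendsto_one_div_add_atTop_nhds_zero_nat (𝕜 := ℝ)
      simpa using this.mul_const v
    have h4 := ((hα.continuous_orbit x).tendsto 0).comp h3
    rw [hα.map_zero_time] at h4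
    exact tendsto_const_nhds.smul h4

lemma eq_zero_of_mult (hα : IsCStarDynSys α) {x : X} (h : ∀ g, Nice g → mult α g x = 0) :
    x = 0 := by
  obtain ⟨g, hg, hg1, -⟩ := exists_bump
  refine tendsto_nhds_unique (hα.tendsto_mult hg (hg1 0 (by simp)) x) ?_
  have : ∀ n : ℕ, mult α (fun ξ => g ((ξ - 0) / (n + 1 : ℝ))) x = 0 := fun n =>
    h _ (hg.comp_div (by positivity) 0)
  simp only [this]
  exact tendsto_const_nhds

end IsCStarDynSys

end

section

/-- The `L¹` modulus of continuity of a kernel. -/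
def l1Mod (k : ℝ → ℂ) (a : ℝ) : ℝ := ∫ v, ‖k (v - a) - k v‖

lemma l1Mod_nonneg (k : ℝ → ℂ) (a : ℝ) : 0 ≤ l1Mod k a := integral_nonneg fun _ => norm_nonneg _

lemma l1Mod_le {k : ℝ → ℂ} (hk : Integrable k) (a : ℝ) : l1Mod k a ≤ 2 * ∫ v, ‖k v‖ := by
  unfold l1Mod
  have h1 : Integrable fun v => ‖k (v - a)‖ := (hk.comp_sub_right a).norm
  calc ∫ v, ‖k (v - a) - k v‖ ≤ ∫ v, (‖k (v - a)‖ + ‖k v‖) :=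
        integral_mono ((hk.comp_sub_right a).sub hk).norm (h1.add hk.norm) fun v => norm_sub_le _ _
    _ = _ := by
        rw [integral_add h1 hk.norm, integral_sub_right_eq_self (fun v => ‖k v‖) a, two_mul]

lemma Nice.tendsto_l1Mod {g : ℝ → ℂ} (hg : Nice g) : Tendsto (l1Mod (kern g)) (𝓝 0) (𝓝 0) := by
  obtain ⟨C, hC, hd⟩ := hg.decay_kern
  have h : ContinuousAt (l1Mod (kern g)) 0 := by
    refine continuousAt_of_dominated (bound := fun v => 4 * C * (1 + v ^ 2)⁻¹) ?_ ?_ ?_ ?_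
    · refine Eventually.of_forall fun a => ?_
      exact ((hg.continuous_kern.comp (continuous_id.sub continuous_const)).sub
        hg.continuous_kern).norm.aestronglyMeasurable
    · filter_upwards [Metric.closedBall_mem_nhds (0:ℝ) one_pos] with a ha
      refine ae_of_all _ fun v => ?_
      rw [Metric.mem_closedBall, dist_zero_right, Real.norm_eq_abs, abs_le] at ha
      rw [Real.norm_eq_abs, abs_norm]
      refine (norm_sub_le _ _).trans ?_
      have h1 := hd (v - a)
      have h2 := hd v
      have h3 : (1 + (v - a) ^ 2)⁻¹ ≤ 3 * (1 + v ^ 2)⁻¹ := by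
        rw [← div_eq_mul_inv, le_div_iff₀ (by positivity), inv_mul_le_iff₀ (by positivity)]
        nlinarith [sq_nonneg (v - 2 * a)]
      nlinarith
    · exact integrable_inv_one_add_sq.const_mul _
    · refine ae_of_all _ fun v => ?_
      have := hg.continuous_kern
      fun_prop
  have h0 : l1Mod (kern g) 0 = 0 := by simp [l1Mod]
  simpa [ContinuousAt, h0] using h

namespace IsCStarDynSys

variable {α : ℝ → X → X}

/-- Elements concentrated near one frequency are nearly eigenvectors. -/
lemma norm_apply_sub_le (hα : IsCStarDynSys α) {g : ℝ → ℂ} (hg : Nice g) {r : ℝ} (hr : 0 < r)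
    (γ s : ℝ) {y : X} (hy : mult α (fun ξ => g ((ξ - γ) / r)) y = y) :
    ‖α s y - Complex.exp (-(Complex.I * γ * s)) • y‖ ≤ l1Mod (kern g) (r * s) * ‖y‖ := by
  set k := kern (fun ξ => g ((ξ - γ) / r)) with hk
  have hki : Integrable k := (hg.comp_div hr γ).integrable_kern
  have hy' : smear α k y = y := hy
  have e1 : α s y = ∫ u, k (u - s) • α u y := by
    conv_lhs => rw [← hy', hα.apply_smear hki]
    unfold smear
    rw [← integral_sub_right_eq_self _ s]
    refine integral_congr_ae (ae_of_all _ fun u => ?_)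
    simp only [← hα.map_add_time, sub_add_cancel]
  have e2 : Complex.exp (-(Complex.I * γ * s)) • y =
      ∫ u, (Complex.exp (-(Complex.I * γ * s)) * k u) • α u y := by
    conv_lhs => rw [← hy']
    unfold smear
    rw [← integral_smul]
    simp only [mul_smul]
  rw [e1, e2, ← integral_sub]
  rotate_left
  · exact hα.integrable_smul (hki.comp_sub_right s) y
  · exact hα.integrable_smul (hki.const_mul _) y
  refine (norm_integral_le_integral_norm _).trans_eq ?_
  simp only [← sub_smul, norm_smul, hα.norm_apply]
  rw [integral_mul_const]
  congr 1
  unfold l1Mod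
  have := MeasureTheory.Measure.integral_comp_mul_left
    (fun v : ℝ => ‖kern g (v - r * s) - kern g v‖) r
  rw [abs_of_pos (inv_pos.2 hr), eq_inv_smul_iff₀ hr.ne', ← integral_smul] at this
  rw [← this]
  refine integral_congr_ae (ae_of_all _ fun u => ?_)
  simp only [hk, Nice.kern_comp_div g hr]
  have h1 : Complex.exp (Complex.I * γ * (u - s : ℝ)) =
      Complex.exp (-(Complex.I * γ * s)) * Complex.exp (Complex.I * γ * u) := by
    rw [← Complex.exp_add]; congr 1; push_cast; ring
  rw [h1, mul_smul_comm, ← smul_sub, norm_smul, Real.norm_eq_abs, abs_of_pos hr, mul_assoc,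
    ← mul_sub, ← mul_sub, norm_mul, norm_mul, Complex.norm_exp, Complex.norm_exp]
  simp [mul_sub]

lemma mult_eq_zero_near (hα : IsCStarDynSys α) {x : X} {h : ℝ → ℂ} (hh : Integrable h)
    (hx : smear α h x = 0) {γ : ℝ} (hγ : fourierT h γ ≠ 0) :
    ∃ r > 0, ∀ g, Nice g → (∀ ξ, r < |ξ - γ| → g ξ = 0) → mult α g x = 0 := by
  obtain ⟨b, hb, hb1, -⟩ := exists_bump
  have hlim : Tendsto (fun n : ℕ => ∫ s, ‖h s‖ * l1Mod (kern b) ((n + 1 : ℝ)⁻¹ * s)) atTop (𝓝 0) := by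
    have := tendsto_integral_of_dominated_convergence
      (F := fun (n : ℕ) s => ‖h s‖ * l1Mod (kern b) ((n + 1 : ℝ)⁻¹ * s)) (f := fun _ => (0:ℝ))
      (μ := volume) (fun s => ‖h s‖ * (2 * ∫ v, ‖kern b v‖)) ?_ ?_ ?_ ?_
    · simpa using this
    · intro n
      refine hh.norm.aestronglyMeasurable.mul (StronglyMeasurable.aestronglyMeasurable ?_)
      unfold l1Mod
      have hc : Continuous fun p : ℝ × ℝ =>
          ‖kern b (p.2 - (n + 1 : ℝ)⁻¹ * p.1) - kern b p.2‖ := by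
        have := hb.continuous_kern
        fun_prop
      exact hc.stronglyMeasurable.integral_prod_right
    · exact hh.norm.mul_const _
    · intro n
      refine ae_of_all _ fun s => ?_
      rw [norm_mul, norm_norm, Real.norm_eq_abs, abs_of_nonneg (l1Mod_nonneg _ _)]
      exact mul_le_mul_of_nonneg_left (l1Mod_le hb.integrable_kern _) (norm_nonneg _)
    · refine ae_of_all _ fun s => ?_
      have h3 : Tendsto (fun n : ℕ => (n + 1 : ℝ)⁻¹ * s) atTop (𝓝 0) := by
        have := tendsto_one_div_add_atTop_nhds_zero_nat (𝕜 := ℝ)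
        simpa using this.mul_const s
      simpa using (hb.tendsto_l1Mod.comp h3).const_mul ‖h s‖
  obtain ⟨n, hn⟩ := (hlim.eventually (gt_mem_nhds (norm_pos_iff.2 hγ))).exists
  have hr : (0:ℝ) < (n + 1 : ℝ)⁻¹ := by positivity
  refine ⟨(n + 1 : ℝ)⁻¹, hr, fun g hg hgs => ?_⟩
  set r := (n + 1 : ℝ)⁻¹
  set y := mult α g x with hy
  have hφ := hb.comp_div hr γ
  have h1 : mult α (fun ξ => b ((ξ - γ) / r)) y = y := by
    rw [hy, hα.mult_mult hg hφ]
    congr 1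
    funext ξ
    by_cases hξ : r < |ξ - γ|
    · rw [hgs ξ hξ, zero_mul]
    · rw [hb1, mul_one]
      rw [abs_div, abs_of_pos hr, div_le_one hr]
      exact not_lt.1 hξ
  have h2 : smear α h y = 0 := by
    rw [hy]; unfold mult
    rw [hα.smear_comm hh hg.integrable_kern, hx]
    exact (hα.smearL hg.integrable_kern).map_zero
  have hhe : Integrable fun s : ℝ => h s * Complex.exp (-(Complex.I * γ * s)) := by
    refine Integrable.mul_bdd (c := 1) hh (by fun_prop) (ae_of_all _ fun ξ => ?_)
    rw [Complex.norm_exp]; simp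
  have h3 : fourierT h γ • y = ∫ s, h s • (Complex.exp (-(Complex.I * γ * s)) • y - α s y) := by
    simp only [smul_sub, smul_smul]
    rw [integral_sub (hhe.smul_const y) (hα.integrable_smul hh y)]
    change _ = _ - smear α h y
    rw [h2, sub_zero, integral_smul_const]
    rfl
  have h_int : Integrable fun s => ‖h s‖ * l1Mod (kern b) (r * s) := by
    refine Integrable.mul_bdd (c := 2 * ∫ v, ‖kern b v‖) hh.norm ?_ (ae_of_all _ fun s => ?_)
    · refine StronglyMeasurable.aestronglyMeasurable ?_
      unfold l1Mod
      have hc : Continuous fun p : ℝ × ℝ =>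
          ‖kern b (p.2 - r * p.1) - kern b p.2‖ := by
        have := hb.continuous_kern
        fun_prop
      exact hc.stronglyMeasurable.integral_prod_right
    · rw [Real.norm_eq_abs, abs_of_nonneg (l1Mod_nonneg _ _)]
      exact l1Mod_le hb.integrable_kern _
  have h4 : ‖fourierT h γ‖ * ‖y‖ ≤ (∫ s, ‖h s‖ * l1Mod (kern b) (r * s)) * ‖y‖ := by
    rw [← norm_smul, h3, ← integral_mul_const]
    refine norm_integral_le_of_norm_le (h_int.mul_const ‖y‖) (ae_of_all volume fun s : ℝ => ?_)
    rw [norm_smul, norm_sub_rev, mul_assoc (‖h s‖)]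
    exact mul_le_mul_of_nonneg_left (hα.norm_apply_sub_le hb hr γ s h1) (norm_nonneg (h s))
  by_contra hne
  have hy0 : y ≠ 0 := hne
  have := le_of_mul_le_mul_right h4 (norm_pos_iff.2 hy0)
  linarith

open scoped Manifold in
/-- Wiener's theorem: symbols supported off the spectrum annihilate. -/
lemma mult_eq_zero_of_disjoint (hα : IsCStarDynSys α) {x : X} {F : Set ℝ} (hx : x ∈ specC α F)
    {g : ℝ → ℂ} (hg : Nice g) (hd : Disjoint (tsupport g) F) : mult α g x = 0 := by
  have hloc : ∀ γ ∈ tsupport g, ∃ r > 0, ∀ g', Nice g' →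
      (∀ ξ, r < |ξ - γ| → g' ξ = 0) → mult α g' x = 0 := by
    intro γ hγ
    have : γ ∉ elemSpec α x := fun h => hd.le_bot ⟨hγ, hx h⟩
    simp only [elemSpec, mem_ofPred_eq, not_forall] at this
    obtain ⟨f, hf, hfx, hfγ⟩ := this
    exact hα.mult_eq_zero_near hf hfx hfγ
  choose! r hr hloc using hloc
  obtain ⟨t, ht, htc⟩ := IsCompact.elim_nhds_subcover hg.cpt (fun γ => Metric.ball γ (r γ))
    (fun γ hγ => Metric.ball_mem_nhds γ (hr γ hγ))
  obtain ⟨ρ, hρ⟩ := SmoothPartitionOfUnity.exists_isSubordinate (𝓘(ℝ, ℝ)) (isClosed_tsupport g)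
    (fun i : t => Metric.ball (i : ℝ) (r i)) (fun _ => Metric.isOpen_ball) (by
      intro y hy
      obtain ⟨i, hi, hyi⟩ := mem_iUnion₂.1 (htc hy)
      exact mem_iUnion.2 ⟨⟨i, hi⟩, hyi⟩)
  have hρs : ∀ i, ContDiff ℝ (⊤ : ℕ∞) (fun ξ => (ρ i ξ : ℂ)) := fun i =>
    Complex.ofRealCLM.contDiff.comp (ρ i).contMDiff.contDiff
  have hsum : ∀ s : Finset t, mult α (fun ξ => ∑ i ∈ s, g ξ * (ρ i ξ : ℂ)) x = 0 := by
    intro s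
    induction s using Finset.induction_on with
    | empty => simpa using mult_zero_symbol x
    | insert a s ha ih =>
      have hs : Nice (fun ξ => ∑ i ∈ s, g ξ * (ρ i ξ : ℂ)) := by
        simp only [← Finset.mul_sum]
        exact hg.mul_right (ContDiff.sum fun i _ => hρs i)
      simp only [Finset.sum_insert ha]
      rw [hα.mult_add (hg.mul_right (hρs a)) hs, ih, add_zero]
      refine hloc a (ht a a.2) _ (hg.mul_right (hρs a)) fun ξ hξ => ?_
      have : ρ a ξ = 0 := by
        by_contra hne
        have := hρ a (subset_tsupport _ hne)
        rw [Metric.mem_ball, Real.dist_eq] at this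
        linarith
      rw [this]; simp
  have := hsum Finset.univ
  rw [← this]
  congr 1
  funext ξ
  rw [← Finset.mul_sum]
  by_cases hξ : ξ ∈ tsupport g
  · have h1 := ρ.sum_eq_one hξ
    rw [finsum_eq_sum_of_fintype] at h1
    rw [← Complex.ofReal_sum, h1]; simp
  · rw [image_eq_zero_of_notMem_tsupport hξ, zero_mul]

end IsCStarDynSys

end

section

namespace IsCStarDynSys

variable {α : ℝ → X → X}

lemma smear_mem (hα : IsCStarDynSys α) {S : Submodule ℂ X} (hc : IsClosed (S : Set X))
    (hi : Invariant α (S : Set X)) {f : ℝ → ℂ} (hf : Integrable f) {x : X} (hx : x ∈ S) :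
    smear α f x ∈ S := by
  have : CompleteSpace S := hc.completeSpace_coe
  let v : ℝ → S := fun t => ⟨α t x, hi t x hx⟩
  have hv : Continuous v := (hα.continuous_orbit x).subtype_mk _
  have h_int : Integrable fun t => f t • v t := by
    refine (hf.norm.mul_const ‖x‖).mono'
      (hf.aestronglyMeasurable.smul hv.aestronglyMeasurable) ?_
    filter_upwards with t
    rw [norm_smul]
    exact (congrArg _ (hα.norm_apply t x)).le
  have h := S.subtypeL.integral_comp_comm h_int
  have h2 : smear α f x = S.subtypeL (∫ t, f t • v t) := h ▸ rfl
  rw [h2]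
  exact (∫ t, f t • v t).2

lemma mult_mem (hα : IsCStarDynSys α) {S : Submodule ℂ X} (hc : IsClosed (S : Set X))
    (hi : Invariant α (S : Set X)) {g : ℝ → ℂ} (hg : Nice g) {x : X} (hx : x ∈ S) :
    mult α g x ∈ S := hα.smear_mem hc hi hg.integrable_kern hx

lemma smear_mult_comm (hα : IsCStarDynSys α) {f g : ℝ → ℂ} (hf : Integrable f) (hg : Nice g)
    (x : X) : smear α f (mult α g x) = mult α g (smear α f x) :=
  hα.smear_comm hf hg.integrable_kern x

lemma apply_mult (hα : IsCStarDynSys α) {g : ℝ → ℂ} (hg : Nice g) (t : ℝ) (x : X) :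
    α t (mult α g x) = mult α g (α t x) := hα.apply_smear hg.integrable_kern t x

/-- The system run backwards. -/
lemma mirror (hα : IsCStarDynSys α) : IsCStarDynSys fun t => α (-t) where
  map_zero_time x := by simpa using hα.map_zero_time x
  map_add_time s t x := by rw [← hα.map_add_time]; congr 1; ring
  map_add t := hα.map_add (-t)
  map_smulc t := hα.map_smulc (-t)
  map_mul t := hα.map_mul (-t)
  map_star t := hα.map_star (-t)
  continuous_orbit x := (hα.continuous_orbit x).comp continuous_neg

/-- The spectral subspace of the half-line `[a, ∞)`. -/
def up (hα : IsCStarDynSys α) (a : ℝ) : Submodule ℂ X where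
  carrier := {x | ∀ g, Nice g → ∀ δ > 0, (∀ ξ, a - δ ≤ ξ → g ξ = 0) → mult α g x = 0}
  zero_mem' := fun g hg _ _ _ => (hα.smearL hg.integrable_kern).map_zero
  add_mem' := fun {x y} hx hy g hg δ hδ h => by
    have := (hα.smearL hg.integrable_kern).map_add x y
    simp only [smearL_apply] at this
    have h1 := hx g hg δ hδ h
    have h2 := hy g hg δ hδ h
    unfold mult at *
    rw [this, h1, h2, add_zero]
  smul_mem' := fun c x hx g hg δ hδ h => by
    have := (hα.smearL hg.integrable_kern).map_smul c x
    simp only [smearL_apply] at this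
    have h1 := hx g hg δ hδ h
    unfold mult at *
    rw [this, h1, smul_zero]

/-- The spectral subspace of the half-line `(-∞, b]`. -/
def lo (hα : IsCStarDynSys α) (b : ℝ) : Submodule ℂ X := hα.mirror.up (-b)

lemma mem_up (hα : IsCStarDynSys α) {a : ℝ} {x : X} : x ∈ hα.up a ↔
    ∀ g, Nice g → ∀ δ > 0, (∀ ξ, a - δ ≤ ξ → g ξ = 0) → mult α g x = 0 := Iff.rfl

lemma mirror_lo (hα : IsCStarDynSys α) (b : ℝ) : hα.mirror.lo b = hα.up (-b) := by
  ext x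
  unfold lo
  simp only [mem_up, neg_neg]

lemma mirror_up (hα : IsCStarDynSys α) (b : ℝ) : hα.mirror.up b = hα.lo (-b) := by
  simp [lo]

lemma elemSpec_mirror (x : X) : elemSpec (fun t => α (-t)) x = -elemSpec α x := by
  have key : ∀ (β : ℝ → X → X) γ, γ ∈ elemSpec β x → -γ ∈ elemSpec (fun t => β (-t)) x := by
    intro β γ h f hf hx
    have h1 : smear β (fun t => f (-t)) x = 0 := by
      rw [← hx]; unfold smear
      rw [← integral_neg_eq_self]; simp
    have h2 := h _ hf.comp_neg h1
    rw [← h2]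
    unfold fourierT
    rw [← integral_neg_eq_self]
    simp
  ext γ
  constructor
  · intro h
    simpa using key _ _ h
  · intro h
    simpa using key _ _ h

lemma specC_mirror (F : Set ℝ) : specC (fun t => α (-t)) F = specC α (-F) := by
  ext x
  simp only [specC, mem_ofPred_eq, elemSpec_mirror]
  constructor
  · intro h γ hγ
    exact h (by simpa using hγ)
  · intro h γ hγ
    simpa using h hγ

lemma specC_Ici (hα : IsCStarDynSys α) (a : ℝ) : specC α (Ici a) = hα.up a := by
  ext x
  constructor
  · intro hx g hg δ hδ h
    refine hα.mult_eq_zero_of_disjoint hx hg ?_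
    have : tsupport g ⊆ Iic (a - δ) := by
      refine closure_minimal (fun ξ hξ => ?_) isClosed_Iic
      by_contra hc
      exact hξ (h ξ (not_le.1 hc).le)
    refine disjoint_left.2 fun ξ h1 h2 => ?_
    have := this h1
    simp only [mem_Iic, mem_Ici] at *
    linarith
  · intro hx γ hγ
    by_contra hc
    obtain ⟨b, hb, hb1, hb2⟩ := exists_bump
    have hr : 0 < (a - γ) / 3 := by have := not_le.1 (mem_Ici.not.1 hc); linarith
    have hn := hb.comp_div hr γ
    have := hγ _ hn.integrable_kern (hx _ hn _ hr fun ξ hξ => ?_)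
    · rw [hn.fourierT_kern] at this
      simp [hb1 0 (by simp)] at this
    · apply hb2
      rw [le_abs]; left
      rw [le_div_iff₀ hr]; linarith

lemma specC_Iic (hα : IsCStarDynSys α) (b : ℝ) : specC α (Iic b) = hα.lo b := by
  have := hα.mirror.specC_Ici (-b)
  rwa [specC_mirror, Set.neg_Ici, neg_neg] at this

lemma specC_inter (F F' : Set ℝ) : specC α (F ∩ F') = specC α F ∩ specC α F' := by
  ext x; simp [specC]

lemma specC_Icc (hα : IsCStarDynSys α) (a b : ℝ) :
    specC α (Icc a b) = (hα.up a ⊓ hα.lo b : Submodule ℂ X) := by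
  rw [← Ici_inter_Iic, specC_inter, specC_Ici hα, specC_Iic hα]; rfl

lemma continuous_mult (hα : IsCStarDynSys α) {g : ℝ → ℂ} (hg : Nice g) : Continuous (mult α g) :=
  (hα.smearL hg.integrable_kern).continuous

lemma isClosed_up (hα : IsCStarDynSys α) (a : ℝ) : IsClosed (hα.up a : Set X) := by
  have : (hα.up a : Set X) = ⋂ g, ⋂ (_ : Nice g), ⋂ δ : ℝ, ⋂ (_ : δ > 0),
      ⋂ (_ : ∀ ξ, a - δ ≤ ξ → g ξ = 0), {x | mult α g x = 0} := by
    ext x; simp [mem_up]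
  rw [this]
  refine isClosed_iInter fun g => isClosed_iInter fun hg => isClosed_iInter fun δ =>
    isClosed_iInter fun _ => isClosed_iInter fun _ => ?_
  exact isClosed_eq (hα.continuous_mult hg) continuous_const

lemma isClosed_lo (hα : IsCStarDynSys α) (b : ℝ) : IsClosed (hα.lo b : Set X) :=
  hα.mirror.isClosed_up _

lemma invariant_up (hα : IsCStarDynSys α) (a : ℝ) : Invariant α (hα.up a : Set X) := by
  intro t x hx g hg δ hδ h
  rw [← hα.apply_mult hg, hx g hg δ hδ h, hα.apply_zero]

lemma invariant_lo (hα : IsCStarDynSys α) (b : ℝ) : Invariant α (hα.lo b : Set X) := by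
  intro t x hx
  have := hα.mirror.invariant_up (-b) (-t) x hx
  simp only [neg_neg] at this
  exact this

lemma up_anti (hα : IsCStarDynSys α) {a b : ℝ} (h : a ≤ b) : hα.up b ≤ hα.up a := by
  intro x hx g hg δ hδ h'
  exact hx g hg δ hδ fun ξ hξ => h' ξ (by linarith)

lemma lo_mono (hα : IsCStarDynSys α) {a b : ℝ} (h : a ≤ b) : hα.lo a ≤ hα.lo b :=
  hα.mirror.up_anti (neg_le_neg h)

lemma mem_up_of_forall (hα : IsCStarDynSys α) {a : ℝ} {x : X} (h : ∀ c < a, x ∈ hα.up c) :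
    x ∈ hα.up a := by
  intro g hg δ hδ h'
  exact h (a - δ / 2) (by linarith) g hg (δ / 2) (by linarith) fun ξ hξ => h' ξ (by linarith)

lemma mem_lo_of_forall (hα : IsCStarDynSys α) {b : ℝ} {x : X} (h : ∀ c > b, x ∈ hα.lo c) :
    x ∈ hα.lo b :=
  hα.mirror.mem_up_of_forall fun c hc => by
    have := h (-c) (by linarith)
    simpa [lo] using this

lemma mult_mem_up (hα : IsCStarDynSys α) {a : ℝ} {h : ℝ → ℂ} (hh : Nice h)
    (h0 : ∀ ξ < a, h ξ = 0) (x : X) : mult α h x ∈ hα.up a := by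
  intro g hg δ hδ h'
  rw [hα.mult_mult hh hg]
  refine mult_eq_zero (fun ξ => ?_) x
  rcases lt_or_ge ξ a with hξ | hξ
  · rw [h0 ξ hξ, zero_mul]
  · rw [h' ξ (by linarith), mul_zero]

lemma mult_mirror (g : ℝ → ℂ) (x : X) :
    mult (fun t => α (-t)) (fun ξ => g (-ξ)) x = mult α g x := by
  unfold mult smear
  rw [← integral_neg_eq_self]
  simp [kern_comp_neg]

lemma mult_mem_lo (hα : IsCStarDynSys α) {b : ℝ} {h : ℝ → ℂ} (hh : Nice h)
    (h0 : ∀ ξ > b, h ξ = 0) (x : X) : mult α h x ∈ hα.lo b := by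
  have := hα.mirror.mult_mem_up (Nice.comp_neg hh) (a := -b) (fun ξ hξ => h0 _ (by linarith)) x
  rwa [mult_mirror] at this

lemma mem_lo (hα : IsCStarDynSys α) {b : ℝ} {x : X} : x ∈ hα.lo b ↔
    ∀ g, Nice g → ∀ δ > 0, (∀ ξ, ξ ≤ b + δ → g ξ = 0) → mult α g x = 0 := by
  unfold lo
  rw [mem_up]
  constructor
  · intro h g hg δ hδ h0
    rw [← mult_mirror]
    exact h _ (Nice.comp_neg hg) δ hδ fun ξ hξ => h0 _ (by linarith)
  · intro h g hg δ hδ h0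
    have := h _ (Nice.comp_neg hg) δ hδ fun ξ hξ => h0 _ (by linarith)
    rw [← mult_mirror] at this
    simpa using this

end IsCStarDynSys

end

section

namespace IsCStarDynSys

variable {α : ℝ → X → X}

lemma mult_split (hα : IsCStarDynSys α) {g χ : ℝ → ℂ} (hg : Nice g)
    (hχ : ContDiff ℝ (⊤ : ℕ∞) χ) (x : X) :
    mult α g x = mult α (fun ξ => g ξ * χ ξ) x + mult α (fun ξ => g ξ * (1 - χ ξ)) x := by
  rw [← hα.mult_add (hg.mul_right hχ) (hg.mul_right (contDiff_one_sub hχ))]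
  congr 1
  funext ξ
  ring

/-- Splitting a multiplier into a high-frequency and a low-frequency part. -/
lemma exists_split (hα : IsCStarDynSys α) {S : Submodule ℂ X} (hc : IsClosed (S : Set X))
    (hi : Invariant α (S : Set X)) {a b : ℝ} (hab : a < b) {g : ℝ → ℂ} (hg : Nice g) {x : X}
    (hx : x ∈ S) : ∃ y ∈ S ⊓ hα.up a, ∃ z ∈ S ⊓ hα.lo b, mult α g x = y + z := by
  obtain ⟨χ, hχ, h0, h1⟩ := exists_step hab
  have n1 := hg.mul_right hχ
  have n2 := hg.mul_right (contDiff_one_sub hχ)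
  refine ⟨_, ⟨hα.mult_mem hc hi n1 hx, hα.mult_mem_up n1 (fun ξ hξ => ?_) x⟩, _,
    ⟨hα.mult_mem hc hi n2 hx, hα.mult_mem_lo n2 (fun ξ hξ => ?_) x⟩, hα.mult_split hg hχ x⟩
  · rw [h0 ξ hξ.le, mul_zero]
  · rw [h1 ξ hξ.le, sub_self, mul_zero]

lemma mem_closure_of_mult (hα : IsCStarDynSys α) {N : Set X} (hN : IsClosed N) {x : X}
    (h : ∀ g, Nice g → mult α g x ∈ N) : x ∈ N := by
  obtain ⟨g, hg, hg1, -⟩ := exists_bump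
  refine hN.mem_of_tendsto (hα.tendsto_mult hg (hg1 0 (by simp)) x) (Eventually.of_forall fun n => ?_)
  exact h _ (hg.comp_div (by positivity) 0)

lemma eq_zero_of_up_of_lo (hα : IsCStarDynSys α) {a b : ℝ} (hab : b < a) {x : X}
    (hx : x ∈ hα.up a) (hx' : x ∈ hα.lo b) : x = 0 := by
  refine hα.eq_zero_of_mult fun g hg => ?_
  obtain ⟨χ, hχ, h0, h1⟩ := exists_step (a := b + (a - b) / 3) (b := a - (a - b) / 3) (by linarith)
  have n1 := hg.mul_right hχ
  have n2 := hg.mul_right (contDiff_one_sub hχ)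
  have hp : 0 < (a - b) / 3 := by linarith
  rw [hα.mult_split hg hχ, hα.mem_lo.1 hx' _ n1 _ hp, hx _ n2 _ hp, add_zero]
  · intro ξ hξ
    rw [h1 ξ hξ, sub_self, mul_zero]
  · intro ξ hξ
    rw [h0 ξ hξ, mul_zero]

lemma smear_eq_zero (hα : IsCStarDynSys α) {b δ : ℝ} (hδ : 0 < δ) {f : ℝ → ℂ} (hf : Integrable f)
    (hf0 : ∀ ξ, b - δ ≤ ξ → fourierT f ξ = 0) {y : X} (hy : y ∈ hα.up b) : smear α f y = 0 := by
  refine hα.eq_zero_of_mult fun g hg => ?_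
  obtain ⟨χ, hχ, h0, h1⟩ := exists_step (a := b - δ) (b := b - δ / 2) (by linarith)
  have n1 := hg.mul_right hχ
  have n2 := hg.mul_right (contDiff_one_sub hχ)
  have e1 : mult α (fun ξ => g ξ * (1 - χ ξ)) y = 0 :=
    hy _ n2 (δ / 2) (by linarith) fun ξ hξ => by rw [h1 ξ hξ, sub_self, mul_zero]
  have e2 : smear α f (mult α (fun ξ => g ξ * χ ξ) y) = 0 := by
    rw [hα.smear_mult hf n1]
    refine mult_eq_zero (fun ξ => ?_) y
    rcases lt_or_ge ξ (b - δ) with h | h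
    · rw [h0 ξ h.le]; ring
    · rw [hf0 ξ h, mul_zero]
  rw [← hα.smear_mult_comm hf hg, hα.mult_split hg hχ, e1, add_zero, e2]

/-- The kernels occurring when a multiplier meets a product. -/
lemma fourierT_kern_mul_kern {g h : ℝ → ℂ} (hg : Nice g) (hh : Nice h) (s η : ℝ) :
    fourierT (fun t => kern g t * kern h (s - t)) η =
      ((2 * Real.pi)⁻¹ : ℝ) • ∫ ξ : ℝ, h ξ * Complex.exp (Complex.I * ξ * s) * g (ξ + η) := by
  have h1 : Integrable (fun p : ℝ × ℝ => (kern g p.1 * h p.2) *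
      (Complex.exp (Complex.I * p.2 * (s - p.1 : ℝ)) * Complex.exp (-(Complex.I * η * p.1))))
      (volume.prod volume) := by
    have h0 : Integrable (fun p : ℝ × ℝ => kern g p.1 * h p.2) (volume.prod volume) :=
      hg.integrable_kern.mul_prod hh.integrable
    have h' := integrable_smul_of_bound (E := ℂ) h0
      (v := fun p => Complex.exp (Complex.I * p.2 * (s - p.1 : ℝ)) *
        Complex.exp (-(Complex.I * η * p.1))) (by fun_prop) (C := 1) (by
        intro p
        rw [norm_mul, Complex.norm_exp, Complex.norm_exp]; simp)
    simpa using h'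
  have h2 := integral_integral_swap (f := fun (t ξ : ℝ) => (kern g t * h ξ) *
    (Complex.exp (Complex.I * ξ * (s - t : ℝ)) * Complex.exp (-(Complex.I * η * t)))) h1
  have e1 : fourierT (fun t => kern g t * kern h (s - t)) η = ((2 * Real.pi)⁻¹ : ℝ) •
      ∫ t : ℝ, ∫ ξ : ℝ, (kern g t * h ξ) *
    (Complex.exp (Complex.I * ξ * (s - t : ℝ)) * Complex.exp (-(Complex.I * η * t))) := by
    unfold fourierT
    rw [← integral_smul]
    refine integral_congr_ae (ae_of_all _ fun t => ?_)
    dsimp only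
    conv_lhs => enter [1, 2]; unfold kern
    rw [mul_smul_comm, smul_mul_assoc, ← integral_const_mul, ← integral_mul_const]
    congr 1
    refine integral_congr_ae (ae_of_all _ fun ξ => ?_)
    ring
  rw [e1, h2]
  congr 1
  refine integral_congr_ae (ae_of_all _ fun ξ => ?_)
  have e2 := congrFun hg.fourierT_kern (ξ + η)
  dsimp only
  rw [← e2]
  unfold fourierT
  rw [← integral_const_mul]
  refine integral_congr_ae (ae_of_all _ fun t => ?_)
  have e3 : Complex.exp (Complex.I * ξ * (s - t : ℝ)) * Complex.exp (-(Complex.I * η * t)) =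
      Complex.exp (Complex.I * ξ * s) * Complex.exp (-(Complex.I * (ξ + η : ℝ) * t)) := by
    rw [← Complex.exp_add, ← Complex.exp_add]; congr 1; push_cast; ring
  dsimp only
  rw [e3]; ring

lemma mult_mult_mul (hα : IsCStarDynSys α) {g h : ℝ → ℂ} (hg : Nice g) (hh : Nice h) (x y : X) :
    mult α g (mult α h x * y) =
      ∫ s, α s x * smear α (fun t => kern g t * kern h (s - t)) y := by
  have hk := hh.integrable_kern
  have h1 : Integrable (fun p : ℝ × ℝ => (kern g p.1 * kern h (p.2 - p.1)) • (α p.2 x * α p.1 y))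
      (volume.prod volume) := by
    refine integrable_smul_of_bound ?_ (((hα.continuous_orbit x).comp continuous_snd).mul
      ((hα.continuous_orbit y).comp continuous_fst)) (C := ‖x‖ * ‖y‖)
      (fun p => (norm_mul_le _ _).trans (by simp only [hα.norm_apply]; rfl))
    have := (hg.integrable_kern.convolution_integrand (ContinuousLinearMap.mul ℝ ℂ) hk).swap
    exact this
  have h2 := integral_integral_swap
    (f := fun (t s : ℝ) => (kern g t * kern h (s - t)) • (α s x * α t y)) h1
  have e1 : mult α g (mult α h x * y) =
      ∫ t, ∫ s, (kern g t * kern h (s - t)) • (α s x * α t y) := by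
    conv_lhs => unfold mult smear
    refine integral_congr_ae (ae_of_all _ fun t => ?_)
    dsimp only
    rw [hα.map_mul]
    have e2 : α t (∫ s, kern h s • α s x) = ∫ s, kern h (s - t) • α s x := by
      change α t (smear α (kern h) x) = _
      rw [hα.apply_smear hk]
      unfold smear
      rw [← integral_sub_right_eq_self _ t]
      simp only [← hα.map_add_time, sub_add_cancel]
    have e3 := ((ContinuousLinearMap.mul ℂ X).flip (α t y)).integral_comp_comm
      (hα.integrable_smul (hk.comp_sub_right t) x)
    simp only [ContinuousLinearMap.flip_apply, ContinuousLinearMap.mul_apply', smul_mul_assoc] at e3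
    rw [e2, ← e3, ← integral_smul]
    simp only [mul_smul]
  rw [e1, h2]
  refine integral_congr_ae (ae_of_all _ fun s => ?_)
  dsimp only
  unfold smear
  have hi : Integrable fun t => kern g t * kern h (s - t) := by
    obtain ⟨C, hC, hd⟩ := hh.decay_kern
    refine Integrable.mul_bdd (c := C) hg.integrable_kern
      (hh.continuous_kern.comp (continuous_const.sub continuous_id)).aestronglyMeasurable
      (ae_of_all _ fun t => (hd _).trans ?_)
    exact mul_le_of_le_one_right hC (inv_le_one_of_one_le₀ (by nlinarith [sq_nonneg (s - t)]))
  have e4 := (ContinuousLinearMap.mul ℂ X (α s x)).integral_comp_comm (hα.integrable_smul hi y)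
  simp only [ContinuousLinearMap.mul_apply', mul_smul_comm] at e4
  exact e4

lemma mul_mem_up (hα : IsCStarDynSys α) {a b : ℝ} {x y : X} (hx : x ∈ hα.up a)
    (hy : y ∈ hα.up b) : x * y ∈ hα.up (a + b) := by
  have key : ∀ h, Nice h → mult α h x * y ∈ hα.up (a + b) := by
    intro h hh g hg δ hδ h0
    obtain ⟨χ, hχ, hχ0, hχ1⟩ := exists_step (a := a - δ / 3) (b := a - δ / 4) (by linarith)
    have n1 := hh.mul_right hχ
    have n2 := hh.mul_right (contDiff_one_sub hχ)
    have e1 : mult α (fun ξ => h ξ * (1 - χ ξ)) x = 0 :=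
      hx _ n2 (δ / 4) (by linarith) fun ξ hξ => by rw [hχ1 ξ hξ, sub_self, mul_zero]
    rw [hα.mult_split hh hχ, e1, add_zero, hα.mult_mult_mul hg n1]
    rw [← integral_zero (α := ℝ) (μ := volume) (G := X)]
    refine integral_congr_ae (ae_of_all _ fun s => ?_)
    dsimp only
    rw [hα.smear_eq_zero (b := b) (δ := δ / 3) (by linarith) _ _ hy, mul_zero]
    · obtain ⟨C, hC, hd⟩ := n1.decay_kern
      refine Integrable.mul_bdd (c := C) hg.integrable_kern
        (n1.continuous_kern.comp (continuous_const.sub continuous_id)).aestronglyMeasurable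
        (ae_of_all _ fun t => (hd _).trans ?_)
      exact mul_le_of_le_one_right hC (inv_le_one_of_one_le₀ (by nlinarith [sq_nonneg (s - t)]))
    · intro η hη
      rw [fourierT_kern_mul_kern hg n1]
      have : ∀ ξ : ℝ, h ξ * χ ξ * Complex.exp (Complex.I * ξ * s) * g (ξ + η) = 0 := by
        intro ξ
        rcases lt_or_ge ξ (a - δ / 3) with h' | h'
        · rw [hχ0 ξ h'.le]; ring
        · rw [h0 (ξ + η) (by linarith), mul_zero]
      simp [this]
  have hcl : IsClosed {z : X | z * y ∈ hα.up (a + b)} :=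
    (hα.isClosed_up (a + b)).preimage (continuous_mul_const y)
  exact hα.mem_closure_of_mult hcl key

lemma mul_mem_lo (hα : IsCStarDynSys α) {a b : ℝ} {x y : X} (hx : x ∈ hα.lo a)
    (hy : y ∈ hα.lo b) : x * y ∈ hα.lo (a + b) := by
  have := hα.mirror.mul_mem_up hx hy
  rw [← neg_add] at this
  exact this

lemma star_mem_lo (hα : IsCStarDynSys α) {a : ℝ} {x : X} (hx : x ∈ hα.up a) :
    star x ∈ hα.lo (-a) := by
  rw [hα.mem_lo]
  intro g hg δ hδ h0
  have hn : Nice fun ξ => star (g (-ξ)) := by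
    have h1 := Nice.comp_neg hg
    refine ⟨Complex.conjCLE.contDiff.comp h1.smooth, h1.cpt.comp_left (g := fun z : ℂ => star z) (star_zero _)⟩
  have h1 := hx _ hn δ hδ fun ξ hξ => by rw [h0 _ (by linarith), star_zero]
  have h2 : ∀ u, kern (fun ξ => star (g (-ξ))) u = star (kern g u) := by
    intro u
    unfold kern
    rw [star_smul, ← integral_neg_eq_self]
    simp only [neg_neg]
    congr 1
    rw [Complex.star_def, ← integral_conj]
    refine integral_congr_ae (ae_of_all _ fun ξ => ?_)
    have e : (starRingEnd ℂ) (Complex.exp (Complex.I * ξ * u)) =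
        Complex.exp (-(Complex.I * ξ * u)) := by
      rw [← Complex.exp_conj]; simp
    simp [e]
  have h3 : mult α g (star x) = star (mult α (fun ξ => star (g (-ξ))) x) := by
    have := (starL' ℝ (A := X)).toContinuousLinearMap.integral_comp_comm (hα.integrable_smul hn.integrable_kern x)
    simp only [ContinuousLinearEquiv.coe_coe, starL'_apply, star_smul, h2, star_star, ← hα.map_star] at this
    unfold mult smear
    simp only [h2]
    exact this
  rw [h3, h1, star_zero]

lemma star_mem_up (hα : IsCStarDynSys α) {a : ℝ} {x : X} (hx : x ∈ hα.lo a) :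
    star x ∈ hα.up (-a) := by
  have := hα.mirror.star_mem_lo hx
  rw [mirror_lo, neg_neg] at this
  exact this

end IsCStarDynSys

end

section

lemma mul_one_sub_pow_le {x : ℝ} (h0 : 0 ≤ x) (h1 : x ≤ 1) (m : ℕ) :
    x * (1 - x) ^ (2 * m) ≤ ((m : ℝ) + 1)⁻¹ := by
  have hb : 1 + (m : ℝ) * x ≤ (1 + x) ^ m := one_add_mul_le_pow (by linarith) m
  have h2 : (1 - x) ^ m * (1 + x) ^ m ≤ 1 := by
    rw [← mul_pow]; exact pow_le_one₀ (by nlinarith) (by nlinarith)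
  have h3 : 0 ≤ (1 - x) ^ m := by have : 0 ≤ 1 - x := by linarith
                                  positivity
  have h4 : (1 - x) ^ m ≤ 1 := pow_le_one₀ (by linarith) (by linarith)
  have h5 : (1 - x) ^ (2 * m) ≤ (1 - x) ^ m := by
    rw [two_mul, pow_add]; exact mul_le_of_le_one_right h3 h4
  rw [← one_div, le_div_iff₀ (by positivity)]
  have h6 : (1 - x) ^ m * (1 + m * x) ≤ 1 :=
    (mul_le_mul_of_nonneg_left hb h3).trans h2
  have h7 : (0:ℝ) ≤ m := by positivity
  have h8 : x * (1 - x) ^ (2 * m) * (m + 1) ≤ x * (1 - x) ^ m * (m + 1) := by gcongr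
  nlinarith [mul_nonneg h0 h3]

/-- Iterated damping of `b` by `1 - s b⋆b`. -/
def damp (s : ℝ) (b : X) : ℕ → X
  | 0 => b
  | n + 1 => damp s b n - (s : ℂ) • (damp s b n * (star b * b))

lemma tendsto_damp (b : X) : Tendsto (damp (‖star b * b‖ + 1)⁻¹ b) atTop (𝓝 0) := by
  let _ : NonUnitalCStarAlgebra X := { }
  set h := star b * b with hh
  have hsa : IsSelfAdjoint h := IsSelfAdjoint.star_mul_self b
  have hn : 0 ≤ h := star_mul_self_nonneg b
  set s := (‖h‖ + 1)⁻¹ with hs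
  have hs0 : 0 < s := by positivity
  have hq : ∀ t ∈ quasispectrum ℝ h, 0 ≤ t ∧ t ≤ ‖h‖ := fun t ht =>
    ⟨quasispectrum_nonneg_of_nonneg h hn t ht, (le_abs_self t).trans
      (NonUnitalIsometricContinuousFunctionalCalculus.norm_quasispectrum_le h ht hsa)⟩
  have key : ∀ n, star (damp s b n) * damp s b n = cfcₙ (fun t : ℝ => t * (1 - s * t) ^ (2 * n)) h := by
    intro n
    induction n with
    | zero => simpa [damp] using (cfcₙ_id' ℝ h).symm
    | succ n ih =>
      have e : star (damp s b (n + 1)) * damp s b (n + 1) =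
          (star (damp s b n) * damp s b n) - (s : ℂ) • ((star (damp s b n) * damp s b n) * h)
          - (s : ℂ) • (h * ((star (damp s b n) * damp s b n)
          - (s : ℂ) • ((star (damp s b n) * damp s b n) * h))) := by
        simp only [damp, star_sub, star_smul, star_mul _ h, sub_mul, mul_sub,
          smul_mul_assoc, mul_smul_comm, mul_assoc, Complex.star_def, Complex.conj_ofReal, ← hh,
          hsa.star_eq, smul_sub]
        abel
      have hr : ∀ y : X, (s : ℂ) • y = s • y := fun y => rfl
      have m1 : ∀ f : ℝ → ℝ, Continuous f → f 0 = 0 →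
          cfcₙ f h * h = cfcₙ (fun t => f t * t) h := by
        intro f hf hf0
        conv_lhs => enter [2]; rw [← cfcₙ_id' ℝ h]
        exact (cfcₙ_mul _ _ h hf.continuousOn hf0 continuousOn_id rfl).symm
      have m2 : ∀ f : ℝ → ℝ, Continuous f → f 0 = 0 →
          h * cfcₙ f h = cfcₙ (fun t => t * f t) h := by
        intro f hf hf0
        conv_lhs => enter [1]; rw [← cfcₙ_id' ℝ h]
        exact (cfcₙ_mul _ _ h continuousOn_id rfl hf.continuousOn hf0).symm
      have m3 : ∀ f : ℝ → ℝ, Continuous f → f 0 = 0 → ∀ g : ℝ → ℝ, Continuous g → g 0 = 0 →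
          cfcₙ f h - s • cfcₙ g h = cfcₙ (fun t => f t - s * g t) h := by
        intro f hf hf0 g hg hg0
        rw [← cfcₙ_const_mul s g h hg.continuousOn hg0]
        exact (cfcₙ_sub _ _ h hf.continuousOn hf0 (hg.const_mul s |>.continuousOn)
          (by simp [hg0])).symm
      rw [e, ih]
      simp only [hr]
      rw [m1 _ (by fun_prop) (by simp), m3 _ (by fun_prop) (by simp) _ (by fun_prop) (by simp),
        m2 _ (by fun_prop) (by simp), m3 _ (by fun_prop) (by simp) _ (by fun_prop) (by simp)]
      refine cfcₙ_congr fun t _ => ?_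
      ring
  have hb : ∀ n, ‖damp s b n‖ * ‖damp s b n‖ ≤ s⁻¹ * ((n : ℝ) + 1)⁻¹ := by
    intro n
    rw [← CStarRing.norm_star_mul_self, key n]
    refine norm_cfcₙ_le fun t ht => ?_
    obtain ⟨h0, h1⟩ := hq t ht
    have h2 : s * t ≤ 1 := by
      rw [hs, inv_mul_le_iff₀ (by positivity)]; linarith
    have h3 := mul_one_sub_pow_le (mul_nonneg hs0.le h0) h2 n
    have h4 : 0 ≤ (1 - s * t) ^ (2 * n) := by
      have : 0 ≤ 1 - s * t := by linarith
      positivity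
    rw [Real.norm_eq_abs, abs_of_nonneg (mul_nonneg h0 h4), mul_comm s⁻¹, ← div_eq_mul_inv, le_div_iff₀ hs0]
    linarith [h3, mul_comm (t * (1 - s * t) ^ (2 * n)) s, mul_assoc s t ((1 - s * t) ^ (2 * n))]
  have hl : Tendsto (fun n : ℕ => s⁻¹ * ((n : ℝ) + 1)⁻¹) atTop (𝓝 0) := by
    have := tendsto_one_div_add_atTop_nhds_zero_nat (𝕜 := ℝ)
    simpa using this.const_mul s⁻¹
  have h5 := squeeze_zero (fun n => mul_self_nonneg _) hb hl
  rw [tendsto_zero_iff_norm_tendsto_zero]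
  have h6 := h5.sqrt
  simpa [Real.sqrt_mul_self (norm_nonneg _)] using h6

/-- Membership in a closed subspace can be tested after multiplying by `b⋆b`. -/
lemma mem_of_mul_star_mul {N : Submodule ℂ X} (hN : IsClosed (N : Set X)) {b : X}
    (hb : b * (star b * b) ∈ N) (h : ∀ n ∈ N, n * (star b * b) ∈ N) : b ∈ N := by
  set s := (‖star b * b‖ + 1)⁻¹
  have key : ∀ n, b - damp s b n ∈ N := by
    intro n
    induction n with
    | zero => simp [damp]
    | succ n ih =>
      have e : b - damp s b (n + 1) = (b - damp s b n) +
          (s : ℂ) • (b * (star b * b) - (b - damp s b n) * (star b * b)) := by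
        simp only [damp, sub_mul]
        rw [sub_sub_cancel]; abel
      rw [e]
      exact N.add_mem ih (N.smul_mem _ (N.sub_mem hb (h _ ih)))
  have := (tendsto_const_nhds (x := b)).sub (tendsto_damp b)
  rw [sub_zero] at this
  exact hN.mem_of_tendsto this (Eventually.of_forall key)

/-- Membership in a closed subspace can be tested after multiplying by `bb⋆`. -/
lemma mem_of_mul_star_mul' {N : Submodule ℂ X} (hN : IsClosed (N : Set X)) {b : X}
    (hb : b * star b * b ∈ N) (h : ∀ n ∈ N, b * star b * n ∈ N) : b ∈ N := by
  let N' : Submodule ℂ X :=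
    { carrier := {x | star x ∈ N}
      zero_mem' := by simp
      add_mem' := fun hx hy => by simpa using N.add_mem hx hy
      smul_mem' := fun c x hx => by simpa using N.smul_mem _ hx }
  have := mem_of_mul_star_mul (N := N') (hN.preimage continuous_star) (b := star b)
    (by simpa [N', mul_assoc] using hb)
    (fun n hn => by simpa [N', mul_assoc] using h _ hn)
  simpa [N'] using this

end

section

/-- The closed linear span, as a submodule. -/
def cspan (S : Set X) : Submodule ℂ X := (Submodule.span ℂ S).topologicalClosure

lemma isClosed_cspan (S : Set X) : IsClosed (cspan S : Set X) :=
  Submodule.isClosed_topologicalClosure _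

lemma subset_cspan (S : Set X) : S ⊆ cspan S :=
  Submodule.subset_span.trans (Submodule.le_topologicalClosure _)

lemma cspan_le {S : Set X} {N : Submodule ℂ X} (hN : IsClosed (N : Set X)) (h : S ⊆ N) :
    cspan S ≤ N :=
  Submodule.topologicalClosure_minimal _ (Submodule.span_le.2 h) hN

/-- The elements that left multiplication by `w` sends into `N`. -/
def mulInto (N : Submodule ℂ X) (w : X) : Submodule ℂ X where
  carrier := {x | w * x ∈ N}
  zero_mem' := by simp
  add_mem' hx hy := by simpa [mul_add] using N.add_mem hx hy
  smul_mem' c x hx := by simpa [mul_smul_comm] using N.smul_mem c hx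

/-- The elements that right multiplication by `w` sends into `N`. -/
def mulInto' (N : Submodule ℂ X) (w : X) : Submodule ℂ X where
  carrier := {x | x * w ∈ N}
  zero_mem' := by simp
  add_mem' hx hy := by simpa [add_mul] using N.add_mem hx hy
  smul_mem' c x hx := by simpa [smul_mul_assoc] using N.smul_mem c hx

lemma isClosed_mulInto {N : Submodule ℂ X} (hN : IsClosed (N : Set X)) (w : X) :
    IsClosed (mulInto N w : Set X) := hN.preimage (continuous_const.mul continuous_id)

lemma isClosed_mulInto' {N : Submodule ℂ X} (hN : IsClosed (N : Set X)) (w : X) :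
    IsClosed (mulInto' N w : Set X) := hN.preimage (continuous_id.mul continuous_const)

lemma mul_mem_of_cspan {S : Set X} {N : Submodule ℂ X} (hN : IsClosed (N : Set X)) {w x : X}
    (h : ∀ s ∈ S, w * s ∈ N) (hx : x ∈ cspan S) : w * x ∈ N :=
  cspan_le (isClosed_mulInto hN w) (fun s hs => h s hs) hx

lemma mul_mem_of_cspan' {S : Set X} {N : Submodule ℂ X} (hN : IsClosed (N : Set X)) {w x : X}
    (h : ∀ s ∈ S, s * w ∈ N) (hx : x ∈ cspan S) : x * w ∈ N :=
  cspan_le (isClosed_mulInto' hN w) (fun s hs => h s hs) hx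

/-- The adjoints of the elements of `N`. -/
def stars (N : Submodule ℂ X) : Submodule ℂ X where
  carrier := {x | star x ∈ N}
  zero_mem' := by simp
  add_mem' hx hy := by simpa using N.add_mem hx hy
  smul_mem' c x hx := by simpa using N.smul_mem (star c) hx

lemma mem_stars {N : Submodule ℂ X} {x : X} : x ∈ stars N ↔ star x ∈ N := Iff.rfl

lemma isClosed_stars {N : Submodule ℂ X} (hN : IsClosed (N : Set X)) :
    IsClosed (stars N : Set X) := hN.preimage continuous_star

/-- Closed invariant subspaces. -/
structure CI (α : ℝ → X → X) (S : Submodule ℂ X) : Prop where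
  closed : IsClosed (S : Set X)
  inv : Invariant α (S : Set X)

namespace CI

variable {α : ℝ → X → X} {S T : Submodule ℂ X}

lemma inf (hS : CI α S) (hT : CI α T) : CI α (S ⊓ T) :=
  ⟨hS.closed.inter hT.closed, fun t x hx => ⟨hS.inv t x hx.1, hT.inv t x hx.2⟩⟩

lemma mirror (hS : CI α S) : CI (fun t => α (-t)) S := ⟨hS.closed, fun t => hS.inv (-t)⟩

lemma top : CI α (⊤ : Submodule ℂ X) := ⟨isClosed_univ, fun _ _ _ => trivial⟩

lemma bot (hα : IsCStarDynSys α) : CI α (⊥ : Submodule ℂ X) :=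
  ⟨isClosed_singleton, fun t x hx => by
    rw [SetLike.mem_coe, Submodule.mem_bot] at *
    rw [hx, hα.apply_zero]⟩

lemma up (hα : IsCStarDynSys α) (a : ℝ) : CI α (hα.up a) := ⟨hα.isClosed_up a, hα.invariant_up a⟩

lemma lo (hα : IsCStarDynSys α) (a : ℝ) : CI α (hα.lo a) := ⟨hα.isClosed_lo a, hα.invariant_lo a⟩

lemma cspan (hα : IsCStarDynSys α) {S : Set X} (hS : Invariant α S) : CI α (cspan S) := by
  refine ⟨isClosed_cspan S, fun t => ?_⟩
  have : PeligradMax.cspan S ≤ (PeligradMax.cspan S).comap (hα.clm t : X →ₗ[ℂ] X) := by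
    refine cspan_le ?_ fun s hs => ?_
    · exact (isClosed_cspan S).preimage (hα.clm t).continuous
    · exact subset_cspan S (hS t s hs)
  intro x hx
  exact this hx

end CI

namespace IsCStarDynSys

variable {α : ℝ → X → X}

lemma le_of_split (hα : IsCStarDynSys α) {S N : Submodule ℂ X} (hS : CI α S)
    (hN : IsClosed (N : Set X)) {a b : ℝ} (hab : a < b) (h1 : S ⊓ hα.up a ≤ N)
    (h2 : S ⊓ hα.lo b ≤ N) : S ≤ N := by
  intro x hx
  refine hα.mem_closure_of_mult hN fun g hg => ?_
  obtain ⟨y, hy, z, hz, e⟩ := hα.exists_split hS.closed hS.inv hab hg hx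
  rw [e]
  exact N.add_mem (h1 hy) (h2 hz)

lemma mem_of_separated (hα : IsCStarDynSys α) {S Q : Submodule ℂ X} (hS : CI α S) {a b : ℝ}
    (hab : a < b) (hQ : Q ≤ hα.up b) {x : X} (hx : x ∈ hα.lo a)
    (hx' : x ∈ (S ⊔ Q).topologicalClosure) : x ∈ S := by
  refine hα.mem_closure_of_mult hS.closed fun g hg => ?_
  have hp : 0 < (b - a) / 3 := by linarith
  obtain ⟨χ, hχ, h0, h1⟩ := exists_step (a := a + (b - a) / 3) (b := b - (b - a) / 3) (by linarith)
  have n1 := hg.mul_right hχ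
  have n2 := hg.mul_right (contDiff_one_sub hχ)
  rw [hα.mult_split hg hχ, hα.mem_lo.1 hx _ n1 _ hp, zero_add]
  · have : (S ⊔ Q).topologicalClosure ≤
        S.comap (hα.smearL n2.integrable_kern : X →ₗ[ℂ] X) := by
      refine Submodule.topologicalClosure_minimal _ (sup_le ?_ ?_) ?_
      · exact fun y hy => hα.mult_mem hS.closed hS.inv n2 hy
      · intro y hy
        have : mult α _ y = 0 := hQ hy _ n2 _ hp fun ξ hξ => by rw [h1 ξ hξ, sub_self, mul_zero]
        change mult α _ y ∈ S
        rw [this]; exact S.zero_mem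
      · exact hS.closed.preimage (hα.smearL n2.integrable_kern).continuous
    exact this hx'
  · intro ξ hξ
    rw [h0 ξ hξ, mul_zero]

lemma exists_band (hα : IsCStarDynSys α) {g : ℝ → ℂ} (hg : Nice g) :
    ∃ R : ℝ, 0 < R ∧ ∀ x, mult α g x ∈ hα.up (-R) ∧ mult α g x ∈ hα.lo R := by
  obtain ⟨R, hR, h⟩ := hg.cpt.isCompact.isBounded.exists_pos_norm_le
  have h' : ∀ ξ, R < |ξ| → g ξ = 0 := fun ξ hξ => by
    by_contra hne
    exact absurd (h ξ (subset_tsupport g hne)) (not_le.2 hξ)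
  refine ⟨R, hR, fun x => ⟨hα.mult_mem_up hg (fun ξ hξ => h' ξ ?_) x,
    hα.mult_mem_lo hg (fun ξ hξ => h' ξ ?_) x⟩⟩
  · rw [lt_abs]; right; linarith
  · rw [lt_abs]; left; linarith

lemma le_of_inf_up (hα : IsCStarDynSys α) {S N : Submodule ℂ X} (hS : CI α S)
    (hN : IsClosed (N : Set X)) (h : ∀ a, S ⊓ hα.up a ≤ N) : S ≤ N := by
  intro x hx
  refine hα.mem_closure_of_mult hN fun g hg => ?_
  obtain ⟨R, -, hR⟩ := hα.exists_band hg
  exact h _ ⟨hα.mult_mem hS.closed hS.inv hg hx, (hR x).1⟩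

/-- A closed subspace containing all narrow bands of `S` contains `S`. -/
lemma le_of_bands (hα : IsCStarDynSys α) {S N : Submodule ℂ X} (hS : CI α S)
    (hN : IsClosed (N : Set X)) {w : ℝ} (hw : 0 < w)
    (h : ∀ c, S ⊓ (hα.up c ⊓ hα.lo (c + w)) ≤ N) : S ≤ N := by
  have key : ∀ n : ℕ, ∀ c, S ⊓ (hα.up c ⊓ hα.lo (c + n * (w / 2) + w)) ≤ N := by
    intro n
    induction n with
    | zero => intro c; simpa using h c
    | succ n ih =>
      intro c
      refine hα.le_of_split (hS.inf ((CI.up hα _).inf (CI.lo hα _))) hN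
        (a := c + w / 2) (b := c + w) (by linarith) ?_ ?_
      · rintro x ⟨⟨h1, -, h3⟩, h4⟩
        refine ih (c + w / 2) ⟨h1, h4, ?_⟩
        have e : c + w / 2 + n * (w / 2) + w = c + (n + 1 : ℕ) * (w / 2) + w := by push_cast; ring
        rwa [e]
      · rintro x ⟨⟨h1, h2, -⟩, h4⟩
        exact h c ⟨h1, h2, h4⟩
  intro x hx
  refine hα.mem_closure_of_mult hN fun g hg => ?_
  obtain ⟨R, hR0, hR⟩ := hα.exists_band hg
  obtain ⟨n, hn⟩ := exists_nat_gt (2 * R / (w / 2))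
  rw [div_lt_iff₀ (by positivity)] at hn
  exact key n (-R) ⟨hα.mult_mem hS.closed hS.inv hg hx, (hR x).1,
    hα.lo_mono (by linarith) (hR x).2⟩

end IsCStarDynSys

end

section

/-- Closed invariant two-sided ideals. -/
structure CIdeal (α : ℝ → X → X) (I : Submodule ℂ X) : Prop extends CI α I where
  mulL : ∀ x, ∀ y ∈ I, x * y ∈ I
  mulR : ∀ x, ∀ y ∈ I, y * x ∈ I

namespace CIdeal

variable {α : ℝ → X → X} {I J : Submodule ℂ X}

lemma mirror (hI : CIdeal α I) : CIdeal (fun t => α (-t)) I :=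
  { hI.toCI.mirror with mulL := hI.mulL, mulR := hI.mulR }

lemma star_mem (hI : CIdeal α I) {x : X} (hx : x ∈ I) : star x ∈ I := by
  refine mem_of_mul_star_mul' hI.closed ?_ fun n hn => hI.mulL _ _ hn
  rw [star_star]
  exact hI.mulR _ _ (hI.mulL _ _ hx)

lemma inf (hI : CIdeal α I) (hJ : CIdeal α J) : CIdeal α (I ⊓ J) :=
  { hI.toCI.inf hJ.toCI with
    mulL := fun x y hy => ⟨hI.mulL x y hy.1, hJ.mulL x y hy.2⟩
    mulR := fun x y hy => ⟨hI.mulR x y hy.1, hJ.mulR x y hy.2⟩ }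

end CIdeal

/-- A maximal closed subalgebra, phrased with submodules. -/
def MaxSub (A : Submodule ℂ X) : Prop :=
  ∀ W : Submodule ℂ X, IsClosed (W : Set X) → (∀ x ∈ W, ∀ y ∈ W, x * y ∈ W) → A ≤ W →
    W = A ∨ W = ⊤

lemma mul_mem_topologicalClosure {S : Submodule ℂ X} (h : ∀ x ∈ S, ∀ y ∈ S, x * y ∈ S) {x y : X}
    (hx : x ∈ S.topologicalClosure) (hy : y ∈ S.topologicalClosure) :
    x * y ∈ S.topologicalClosure := by
  have hc := S.isClosed_topologicalClosure
  have h1 : ∀ x ∈ S, x * y ∈ S.topologicalClosure := fun x hx =>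
    S.topologicalClosure_minimal (t := mulInto S.topologicalClosure x)
      (fun z hz => S.le_topologicalClosure (h x hx z hz)) (isClosed_mulInto hc x) hy
  exact S.topologicalClosure_minimal (t := mulInto' S.topologicalClosure y) (fun x hx => h1 x hx)
    (isClosed_mulInto' hc y) hx

/-- A system whose nonnegative spectral subspace is maximal and whose spectrum accumulates at `0`,
with the simple ideal generated by the positive part of the spectrum. -/
structure Setup (α : ℝ → X → X) (Y : Submodule ℂ X) : Prop extends CIdeal α Y where
  dyn : IsCStarDynSys α
  maxi : MaxSub (dyn.up 0)
  acc : ∀ ε > (0 : ℝ), ∃ j k : ℝ, 0 < j ∧ j ≤ k ∧ k < ε ∧ ∃ x ∈ dyn.up j ⊓ dyn.lo k, x ≠ 0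
  up_le : ∀ c > (0 : ℝ), dyn.up c ≤ Y
  lo_le : ∀ c < (0 : ℝ), dyn.lo c ≤ Y
  simple : ∀ I : Submodule ℂ X, CIdeal α I → Y ⊓ I = ⊥ ∨ Y ≤ I

lemma sup_ideal_eq {A I : Submodule ℂ X} (hmax : MaxSub A) (hA : ∀ x ∈ A, ∀ y ∈ A, x * y ∈ A)
    (hL : ∀ x, ∀ y ∈ I, x * y ∈ I) (hR : ∀ x, ∀ y ∈ I, y * x ∈ I) :
    I ≤ A ∨ (I ⊔ A).topologicalClosure = ⊤ := by
  have := hmax (I ⊔ A).topologicalClosure (Submodule.isClosed_topologicalClosure _)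
    (fun x hx y hy => mul_mem_topologicalClosure ?_ hx hy)
    (le_sup_right.trans (Submodule.le_topologicalClosure _))
  · refine this.imp_left fun h => ?_
    rw [← h]
    exact le_sup_left.trans (Submodule.le_topologicalClosure _)
  · intro x hx y hy
    obtain ⟨i, hi, a, ha, rfl⟩ := Submodule.mem_sup.1 hx
    obtain ⟨j, hj, b, hb, rfl⟩ := Submodule.mem_sup.1 hy
    rw [add_mul, mul_add, mul_add, add_assoc]
    have := I.add_mem (I.add_mem (hL i j hj) (hR b i hi)) (hL a j hj)
    have e : i * j + (i * b + (a * j + a * b)) = (i * j + i * b + a * j) + a * b := by abel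
    rw [e]
    exact Submodule.add_mem_sup this (hA a ha b hb)

/-- The ideal generated by the strictly positive part of the spectrum. -/
def posIdeal {α : ℝ → X → X} (hα : IsCStarDynSys α) : Submodule ℂ X :=
  sInf {I | CIdeal α I ∧ ∀ c > (0 : ℝ), hα.up c ≤ I}

section posIdeal

variable {α : ℝ → X → X} (hα : IsCStarDynSys α)

lemma posIdeal_le {I : Submodule ℂ X} (hI : CIdeal α I) (h : ∀ c > (0 : ℝ), hα.up c ≤ I) :
    posIdeal hα ≤ I := sInf_le ⟨hI, h⟩

lemma up_le_posIdeal {c : ℝ} (hc : 0 < c) : hα.up c ≤ posIdeal hα := le_sInf fun _ hI => hI.2 c hc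

lemma cIdeal_posIdeal : CIdeal α (posIdeal hα) where
  closed := by
    have : (posIdeal hα : Set X) =
        ⋂ I ∈ {I : Submodule ℂ X | CIdeal α I ∧ ∀ c > (0 : ℝ), hα.up c ≤ I}, (I : Set X) := by
      rw [posIdeal, Submodule.coe_sInf]
    rw [this]
    exact isClosed_biInter fun I hI => hI.1.closed
  inv t x hx := by
    simp only [posIdeal, SetLike.mem_coe, Submodule.mem_sInf] at *
    exact fun I hI => hI.1.inv t x (hx I hI)
  mulL x y hy := by
    simp only [posIdeal, Submodule.mem_sInf] at *
    exact fun I hI => hI.1.mulL x y (hy I hI)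
  mulR x y hy := by
    simp only [posIdeal, Submodule.mem_sInf] at *
    exact fun I hI => hI.1.mulR x y (hy I hI)

/-- The right annihilator of an ideal. -/
def rightAnn (K : Submodule ℂ X) : Submodule ℂ X where
  carrier := {z | ∀ k ∈ K, k * z = 0}
  zero_mem' := by simp
  add_mem' hx hy k hk := by rw [mul_add, hx k hk, hy k hk, add_zero]
  smul_mem' c x hx k hk := by rw [mul_smul_comm, hx k hk, smul_zero]

include hα in
lemma CIdeal.rightAnn {K : Submodule ℂ X} (hK : CIdeal α K) : CIdeal α (rightAnn K) where
  closed := by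
    have : (PeligradMax.rightAnn K : Set X) = ⋂ k ∈ K, {z | k * z = 0} := by
      ext z; simp [PeligradMax.rightAnn]
    rw [this]
    exact isClosed_biInter fun k _ =>
      isClosed_eq (continuous_const.mul continuous_id) continuous_const
  inv t z hz k hk := by
    have := congrArg (α t) (hz _ (hK.inv (-t) k hk))
    rwa [hα.map_mul, hα.apply_zero, ← hα.map_add_time, add_neg_cancel, hα.map_zero_time] at this
  mulL x z hz k hk := by rw [← mul_assoc]; exact hz _ (hK.mulR x k hk)
  mulR x z hz k hk := by rw [← mul_assoc, hz k hk, zero_mul]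

lemma posIdeal_simple (hmax : MaxSub (hα.up 0)) {K : Submodule ℂ X} (hK : CIdeal α K)
    (hKY : K ≤ posIdeal hα) : K = ⊥ ∨ posIdeal hα ≤ K := by
  have hA : ∀ x ∈ hα.up 0, ∀ y ∈ hα.up 0, x * y ∈ hα.up 0 := fun x hx y hy => by
    simpa using hα.mul_mem_up hx hy
  rcases sup_ideal_eq hmax hA hK.mulL hK.mulR with h | h
  · left
    have hlo : K ≤ hα.lo 0 := fun x hx => by
      have := hα.star_mem_lo (h (hK.star_mem hx))
      simpa using this
    have h0 : posIdeal hα ≤ rightAnn K := posIdeal_le hα (hK.rightAnn hα) fun c hc x hx k hk =>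
      hα.eq_zero_of_up_of_lo (a := 0 + c) (b := 0) (by linarith) (hα.mul_mem_up (h hk) hx)
        (hlo (hK.mulR x k hk))
    rw [Submodule.eq_bot_iff]
    intro k hk
    exact CStarRing.mul_star_self_eq_zero_iff k |>.1 (h0 (hKY (hK.star_mem hk)) k hk)
  · right
    refine posIdeal_le hα hK fun c hc x hx => ?_
    have : star x ∈ K := hα.mem_of_separated hK.toCI (a := -c) (b := 0) (by linarith) le_rfl
      (hα.star_mem_lo hx) (by rw [h]; trivial)
    simpa using hK.star_mem this

lemma closure_posIdeal (hmax : MaxSub (hα.up 0))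
    (hacc : ∀ ε > (0 : ℝ), ∃ j k : ℝ, 0 < j ∧ j ≤ k ∧ k < ε ∧ ∃ x ∈ hα.up j ⊓ hα.lo k, x ≠ 0) :
    (posIdeal hα ⊔ hα.up 0).topologicalClosure = ⊤ := by
  have hA : ∀ x ∈ hα.up 0, ∀ y ∈ hα.up 0, x * y ∈ hα.up 0 := fun x hx y hy => by
    simpa using hα.mul_mem_up hx hy
  have hY := cIdeal_posIdeal hα
  refine (sup_ideal_eq hmax hA hY.mulL hY.mulR).resolve_left fun h => ?_
  obtain ⟨j, k, hj, -, -, x, hx, hx0⟩ := hacc 1 one_pos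
  refine hx0 (hα.eq_zero_of_up_of_lo hj hx.1 ?_)
  have := hα.star_mem_lo (h (hY.star_mem (up_le_posIdeal hα hj hx.1)))
  simpa using this

lemma setup_posIdeal (hmax : MaxSub (hα.up 0))
    (hacc : ∀ ε > (0 : ℝ), ∃ j k : ℝ, 0 < j ∧ j ≤ k ∧ k < ε ∧ ∃ x ∈ hα.up j ⊓ hα.lo k, x ≠ 0) :
    Setup α (posIdeal hα) :=
  { cIdeal_posIdeal hα with
    dyn := hα
    maxi := hmax
    acc := hacc
    up_le := fun c hc => up_le_posIdeal hα hc
    lo_le := fun c hc x hx => by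
      have := (cIdeal_posIdeal hα).star_mem
        (up_le_posIdeal hα (c := -c) (by linarith) (hα.star_mem_up hx))
      simpa using this
    simple := fun I hI =>
      (posIdeal_simple hα hmax ((cIdeal_posIdeal hα).inf hI) inf_le_left).imp_right
        fun h => h.trans inf_le_right }

end posIdeal

namespace Setup

variable {α : ℝ → X → X} {Y : Submodule ℂ X}

lemma mirror (h : Setup α Y) : Setup (fun t => α (-t)) Y :=
  { h.toCIdeal.mirror with
    dyn := h.dyn.mirror
    maxi := fun W hW hm hle => by
      rw [h.dyn.mirror_up, neg_zero] at *
      have := h.maxi (stars W) (isClosed_stars hW)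
        (fun x hx y hy => by
          rw [mem_stars, star_mul]; exact hm _ hy _ hx)
        (fun x hx => hle (by simpa using h.dyn.star_mem_lo hx))
      refine this.imp (fun e => le_antisymm (fun x hx => ?_) hle) (fun e => ?_)
      · have h1 : star x ∈ h.dyn.up 0 := by rw [← e, mem_stars, star_star]; exact hx
        simpa using h.dyn.star_mem_lo h1
      · rw [eq_top_iff]
        intro x _
        have h1 : star x ∈ stars W := by rw [e]; trivial
        rwa [mem_stars, star_star] at h1
    acc := fun ε hε => by
      obtain ⟨j, k, hj, hjk, hk, x, hx, hx0⟩ := h.acc ε hε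
      refine ⟨j, k, hj, hjk, hk, star x, ?_, by simpa using hx0⟩
      rw [h.dyn.mirror_up, h.dyn.mirror_lo]
      exact ⟨h.dyn.star_mem_lo hx.1, h.dyn.star_mem_up hx.2⟩
    up_le := fun c hc => by rw [h.dyn.mirror_up]; exact h.lo_le _ (by linarith)
    lo_le := fun c hc => by rw [h.dyn.mirror_lo]; exact h.up_le _ (by linarith)
    simple := fun I hI => h.simple I (by simpa using hI.mirror) }

/-- Consequence of maximality: a closed `A`-module stable under one further element is stable
under everything. -/
lemma mul_mem_of_maxi (h : Setup α Y) {K : Submodule ℂ X} (hK : IsClosed (K : Set X))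
    (hA : ∀ a ∈ h.dyn.up 0, ∀ k ∈ K, a * k ∈ K) {x : X} (hx : x ∉ h.dyn.up 0)
    (hxK : ∀ k ∈ K, x * k ∈ K) (y : X) {k : X} (hk : k ∈ K) : y * k ∈ K := by
  let W : Submodule ℂ X := ⨅ k ∈ K, mulInto' K k
  have hW : ∀ {x}, x ∈ W ↔ ∀ k ∈ K, x * k ∈ K := by
    intro x; simp [W, Submodule.mem_iInf, mulInto']
  have hc : IsClosed (W : Set X) := by
    have : (W : Set X) = ⋂ k ∈ K, (mulInto' K k : Set X) := by
      ext x; simp [W]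
    rw [this]
    exact isClosed_biInter fun k _ => isClosed_mulInto' hK k
  have := h.maxi W hc (fun x hx y hy => hW.2 fun k hk => by
    rw [mul_assoc]; exact hW.1 hx _ (hW.1 hy k hk)) fun a ha => hW.2 (hA a ha)
  rcases this with e | e
  · exact absurd (e ▸ hW.2 hxK) hx
  · exact hW.1 (by rw [e]; trivial) k hk

/-- A form of primeness relative to closed invariant left ideals. -/
lemma le_of_mul_mul_mem (h : Setup α Y) {L : Submodule ℂ X} (hL : CI α L)
    (hXL : ∀ x, ∀ l ∈ L, x * l ∈ L) {Q Z : Set X} (hZ : Invariant α Z)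
    (hQY : Q ⊆ Y) (hZY : Z ⊆ Y) {q₀ : X} (hq₀ : q₀ ∈ Q) (hne : q₀ ≠ 0)
    (hQZ : ∀ q ∈ Q, ∀ x, ∀ z ∈ Z, q * x * z ∈ L) : Z ⊆ L := by
  have hα := h.dyn
  let I : Submodule ℂ X :=
    { carrier := {w | ∀ x, ∀ z ∈ Z, w * x * z ∈ L}
      zero_mem' := by simp
      add_mem' := fun ha hb x z hz => by
        rw [add_mul, add_mul]; exact L.add_mem (ha x z hz) (hb x z hz)
      smul_mem' := fun c w hw x z hz => by
        rw [smul_mul_assoc, smul_mul_assoc]; exact L.smul_mem _ (hw x z hz) }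
  have hI : CIdeal α I :=
    { closed := by
        have : (I : Set X) = ⋂ x, ⋂ z ∈ Z, {w | w * x * z ∈ L} := by ext w; simp [I]
        rw [this]
        exact isClosed_iInter fun x => isClosed_biInter fun z _ =>
          hL.closed.preimage ((continuous_id.mul continuous_const).mul continuous_const)
      inv := fun t w hw x z hz => by
        have := hL.inv t _ (hw (α (-t) x) _ (hZ (-t) z hz))
        rwa [hα.map_mul, hα.map_mul, ← hα.map_add_time, ← hα.map_add_time, add_neg_cancel,
          hα.map_zero_time, hα.map_zero_time] at this
      mulL := fun x w hw y z hz => by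
        rw [mul_assoc x w y, mul_assoc x]; exact hXL _ _ (hw y z hz)
      mulR := fun x w hw y z hz => by
        rw [mul_assoc w x y]; exact hw _ z hz }
  have hYI : Y ≤ I := (h.simple I hI).resolve_left fun e => hne <| by
    have : q₀ ∈ Y ⊓ I := ⟨hQY hq₀, hQZ q₀ hq₀⟩
    rwa [e, Submodule.mem_bot] at this
  intro z hz
  exact mem_of_mul_star_mul' hL.closed (hYI (hZY hz) _ z hz) fun n hn => hXL _ n hn

end Setup

end

section

namespace IsCStarDynSys

variable {α : ℝ → X → X} (hα : IsCStarDynSys α)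
include hα

lemma mul_mem_up' {a b c : ℝ} {x y : X} (hx : x ∈ hα.up a) (hy : y ∈ hα.up b) (h : c ≤ a + b) :
    x * y ∈ hα.up c := hα.up_anti h (hα.mul_mem_up hx hy)

lemma mul_mem_lo' {a b c : ℝ} {x y : X} (hx : x ∈ hα.lo a) (hy : y ∈ hα.lo b) (h : a + b ≤ c) :
    x * y ∈ hα.lo c := hα.lo_mono h (hα.mul_mem_lo hx hy)

lemma mem_lo_zero {x : X} (hx : star x ∈ hα.up 0) : x ∈ hα.lo 0 := by
  simpa using hα.star_mem_lo hx

lemma mem_up_zero {x : X} (hx : star x ∈ hα.lo 0) : x ∈ hα.up 0 := by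
  simpa using hα.star_mem_up hx

end IsCStarDynSys

namespace Setup

variable {α : ℝ → X → X} {Y : Submodule ℂ X}

lemma exists_mul_notMem (h : Setup α Y) : ∃ c > (0 : ℝ), ∃ p ∈ h.dyn.up c, ∃ x, p * x ∉ h.dyn.up 0 := by
  by_contra! h0
  have hα := h.dyn
  have F1 : ∀ {a b : ℝ}, 0 < a → b < 0 → ∀ {x y : X}, x ∈ hα.up a → y ∈ hα.lo b →
      x * y ∈ hα.up 0 ∧ x * y ∈ hα.lo 0 := by
    intro a b ha hb x y hx hy
    refine ⟨h0 a ha x hx y, hα.mem_lo_zero ?_⟩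
    rw [star_mul]
    exact h0 (-b) (by linarith) _ (hα.star_mem_up hy) _
  have F2 : ∀ {a b : ℝ}, 0 < a → 0 < b → ∀ {p q : X}, p ∈ hα.up a → q ∈ hα.up b → p * q = 0 := by
    intro a b ha hb p q hp hq
    have hr := hα.mul_mem_up hp hq
    have h1 : p * (q * star (p * q)) ∈ hα.up a :=
      hα.mul_mem_up' hp (h0 b hb q hq _) (by linarith)
    have h2 := (F1 (by linarith : 0 < a + b) (by linarith : -(a + b) < 0) hr
      (hα.star_mem_lo hr)).2
    rw [mul_assoc] at h2
    have h3 := hα.eq_zero_of_up_of_lo ha h1 h2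
    rw [← mul_assoc] at h3
    exact (CStarRing.mul_star_self_eq_zero_iff _).1 h3
  obtain ⟨j₁, k₁, hj₁, -, -, w, hw, hw0⟩ := h.acc 1 one_pos
  obtain ⟨j₂, k₂, hj₂, hjk₂, hk₂, z₀, hz₀, hz0⟩ := h.acc j₁ hj₁
  have hZ : ((hα.up j₂ ⊓ hα.lo k₂ : Submodule ℂ X) : Set X) ⊆ (⊥ : Submodule ℂ X) := by
    refine h.le_of_mul_mul_mem (CI.bot hα) (by simp) (Q := hα.up j₁)
      ((CI.up hα j₂).inf (CI.lo hα k₂)).inv (h.up_le j₁ hj₁)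
      (fun x hx => h.up_le j₂ hj₂ hx.1) hw.1 hw0 ?_
    intro q hq x z hz
    have key : (⊤ : Submodule ℂ X) ≤ mulInto (mulInto' ⊥ z) q := by
      refine hα.le_of_split CI.top (isClosed_mulInto (isClosed_mulInto' (CI.bot hα).closed z) q)
        (a := -(k₂ + 2 * (j₁ - k₂) / 3)) (b := -(k₂ + (j₁ - k₂) / 3)) (by linarith) ?_ ?_
      · rintro x ⟨-, hx⟩
        exact F2 (a := j₁ + -(k₂ + 2 * (j₁ - k₂) / 3)) (by linarith) hj₂ (hα.mul_mem_up hq hx) hz.1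
      · rintro x ⟨-, hx⟩
        have h1 := F1 hj₁ (by linarith) hq hx
        have h2 := F1 (b := -(k₂ + (j₁ - k₂) / 3) + k₂) hj₁ (by linarith) hq (hα.mul_mem_lo hx hz.2)
        rw [← mul_assoc] at h2
        exact hα.eq_zero_of_up_of_lo hj₂ (hα.mul_mem_up' h1.1 hz.1 (by linarith)) h2.2
    exact key (Submodule.mem_top (x := x))
  exact hz0 (hZ hz₀)

lemma eq_bot_of_left_ideal (h : Setup α Y) {N : Submodule ℂ X} (hN : CI α N)
    (hXN : ∀ x, ∀ n ∈ N, x * n ∈ N) (hNY : N ≤ Y) (hNA : N ≤ h.dyn.up 0) : N = ⊥ := by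
  by_contra hne
  have hα := h.dyn
  obtain ⟨n₀, hn₀, hn0⟩ := N.ne_bot_iff.1 hne
  obtain ⟨c, hc, p₀, hp₀, x₀, hpx⟩ := h.exists_mul_notMem
  have hK : CI α (N ⊓ hα.up c) := hN.inf (CI.up hα c)
  have hXK : ∀ x, ∀ k ∈ N ⊓ hα.up c, x * k ∈ N ⊓ hα.up c := fun x k hk =>
    h.mul_mem_of_maxi hK.closed
      (fun a ha k hk => ⟨hXN a k hk.1, hα.mul_mem_up' ha hk.2 (by linarith)⟩) hpx
      (fun k hk => ⟨hXN _ k hk.1, by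
        rw [mul_assoc]
        exact hα.mul_mem_up' hp₀ (hNA (hXN _ _ hk.1)) (by linarith)⟩) x hk
  have hlo : ∀ {m n : X}, m ∈ N → n ∈ N → star m * n ∈ hα.lo 0 := fun {m n} hm hn => by
    refine hα.mem_lo_zero (hNA ?_)
    rw [star_mul, star_star]
    exact hXN _ _ hm
  have hK0 : ((N ⊓ hα.up c : Submodule ℂ X) : Set X) ⊆ (⊥ : Submodule ℂ X) := by
    refine h.le_of_mul_mul_mem (CI.bot hα) (by simp) (Q := {q | ∃ m ∈ N, ∃ n ∈ N, q = star m * n})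
      hK.inv ?_ (fun x hx => hNY hx.1) ⟨n₀, hn₀, n₀, hn₀, rfl⟩
      (by rwa [Ne, CStarRing.star_mul_self_eq_zero_iff]) ?_
    · rintro q ⟨m, -, n, hn, rfl⟩
      exact hNY (hXN _ n hn)
    · rintro q ⟨m, hm, n, hn, rfl⟩ x z hz
      have h1 := hlo hm (hXN n _ (hXK x z hz).1)
      have h2 := hα.mul_mem_up' (hNA (hXN (star m) n hn)) (hXK x z hz).2 (by linarith : c ≤ 0 + c)
      refine hα.eq_zero_of_up_of_lo hc (x := star m * n * x * z) ?_ ?_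
      · rwa [mul_assoc (star m * n)]
      · rwa [mul_assoc (star m * n), mul_assoc (star m)]
  have : (N : Set X) ⊆ (⊥ : Submodule ℂ X) := by
    refine h.le_of_mul_mul_mem (CI.bot hα) (by simp) (Q := hα.up c) hN.inv (h.up_le c hc) hNY hp₀
      (by rintro rfl; exact hpx (by rw [zero_mul]; exact Submodule.zero_mem _)) ?_
    intro q hq x z hz
    refine hK0 ⟨?_, ?_⟩
    · exact hXN _ _ hz
    · rw [mul_assoc]
      exact hα.mul_mem_up' hq (hNA (hXN x z hz)) (by linarith)
  exact hn0 (this hn₀)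

lemma eq_bot_of_left_ideal' (h : Setup α Y) {N : Submodule ℂ X} (hN : CI α N)
    (hXN : ∀ x, ∀ n ∈ N, x * n ∈ N) (hNY : N ≤ Y) (hNA : N ≤ h.dyn.lo 0) : N = ⊥ :=
  h.mirror.eq_bot_of_left_ideal hN.mirror hXN hNY (by rwa [h.dyn.mirror_up, neg_zero])

end Setup

end

section

/-- The closed left ideal generated by `S`. -/
def leftHull (S : Set X) : Submodule ℂ X := cspan {z | ∃ x, ∃ s ∈ S, z = x * s}

lemma mul_mem_leftHull {S : Set X} (x : X) {s : X} (hs : s ∈ S) : x * s ∈ leftHull S :=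
  subset_cspan _ ⟨x, s, hs, rfl⟩

lemma leftHull_mul_mem {S : Set X} (x : X) {y : X} (hy : y ∈ leftHull S) : x * y ∈ leftHull S :=
  mul_mem_of_cspan (isClosed_cspan _) (by
    rintro _ ⟨z, s, hs, rfl⟩
    rw [← mul_assoc]
    exact mul_mem_leftHull _ hs) hy

lemma subset_leftHull (S : Set X) : S ⊆ leftHull S := fun _ hs =>
  mem_of_mul_star_mul' (isClosed_cspan _) (mul_mem_leftHull _ hs)
    fun _ hn => leftHull_mul_mem _ hn

lemma leftHull_le {S : Set X} {N : Submodule ℂ X} (hN : IsClosed (N : Set X))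
    (h : ∀ x, ∀ s ∈ S, x * s ∈ N) : leftHull S ≤ N :=
  cspan_le hN (by rintro _ ⟨x, s, hs, rfl⟩; exact h x s hs)

lemma leftHull_le_leftHull {S T : Set X} (h : S ⊆ leftHull T) : leftHull S ≤ leftHull T :=
  leftHull_le (isClosed_cspan _) fun _ _ hs => leftHull_mul_mem _ (h hs)

/-- The closed submodule over the nonnegative spectral subspace generated by `S`. -/
def upHull {α : ℝ → X → X} (hα : IsCStarDynSys α) (S : Set X) : Submodule ℂ X :=
  cspan (S ∪ {z | ∃ a ∈ hα.up 0, ∃ s ∈ S, z = a * s})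

variable {α : ℝ → X → X}

lemma CI.leftHull (hα : IsCStarDynSys α) {S : Set X} (hS : Invariant α S) :
    CI α (leftHull S) := by
  refine CI.cspan hα ?_
  rintro t _ ⟨x, s, hs, rfl⟩
  exact ⟨α t x, α t s, hS t s hs, hα.map_mul _ _ _⟩

section upHull

variable (hα : IsCStarDynSys α) {S : Set X}

lemma subset_upHull : S ⊆ upHull hα S := subset_union_left.trans (subset_cspan _)

lemma CI.upHull (hS : Invariant α S) : CI α (upHull hα S) := by
  refine CI.cspan hα ?_
  rintro t _ (h | ⟨a, ha, s, hs, rfl⟩)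
  · exact Or.inl (hS t _ h)
  · exact Or.inr ⟨α t a, hα.invariant_up 0 t a ha, α t s, hS t s hs, hα.map_mul _ _ _⟩

lemma upHull_le {N : Submodule ℂ X} (hN : IsClosed (N : Set X)) (h : S ⊆ N)
    (h' : ∀ a ∈ hα.up 0, ∀ s ∈ S, a * s ∈ N) : upHull hα S ≤ N :=
  cspan_le hN (by
    rintro _ (h1 | ⟨a, ha, s, hs, rfl⟩)
    · exact h h1
    · exact h' a ha s hs)

lemma mul_mem_of_upHull {N : Submodule ℂ X} (hN : IsClosed (N : Set X)) {w x : X}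
    (h : ∀ s ∈ S, w * s ∈ N) (h' : ∀ a ∈ hα.up 0, ∀ s ∈ S, w * (a * s) ∈ N)
    (hx : x ∈ upHull hα S) : w * x ∈ N :=
  upHull_le hα (isClosed_mulInto hN w) (fun s hs => h s hs) (fun a ha s hs => h' a ha s hs) hx

lemma upHull_mul_mem {a x : X} (ha : a ∈ hα.up 0) (hx : x ∈ upHull hα S) : a * x ∈ upHull hα S :=
  mul_mem_of_upHull hα (isClosed_cspan _) (fun s hs => subset_cspan _ (Or.inr ⟨a, ha, s, hs, rfl⟩))
    (fun b hb s hs => by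
      rw [← mul_assoc]
      exact subset_cspan _ (Or.inr ⟨a * b, hα.mul_mem_up' ha hb (by simp), s, hs, rfl⟩)) hx

end upHull

variable {Y B : Submodule ℂ X}

lemma Setup.mul_mem_upHull (h : Setup α Y) {S : Set X} {x : X} (hx : x ∉ h.dyn.up 0)
    (hs : ∀ s ∈ S, x * s ∈ upHull h.dyn S)
    (has : ∀ a ∈ h.dyn.up 0, ∀ s ∈ S, x * (a * s) ∈ upHull h.dyn S) (y : X) {k : X}
    (hk : k ∈ upHull h.dyn S) : y * k ∈ upHull h.dyn S :=
  h.mul_mem_of_maxi (isClosed_cspan _) (fun _ ha _ hk => upHull_mul_mem h.dyn ha hk) hx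
    (fun _ hk => mul_mem_of_upHull h.dyn (isClosed_cspan _) hs has hk) y hk

/-- Nonzero invariant hereditary subalgebras of `Y`. -/
structure BData (α : ℝ → X → X) (Y B : Submodule ℂ X) : Prop extends CI α B where
  setup : Setup α Y
  mul_mem : ∀ b ∈ B, ∀ c ∈ B, b * c ∈ B
  star_mem : ∀ b ∈ B, star b ∈ B
  her : ∀ b ∈ B, ∀ x, ∀ c ∈ B, b * x * c ∈ B
  le : B ≤ Y
  ne : B ≠ ⊥

namespace BData

lemma mirror (h : BData α Y B) : BData (fun t => α (-t)) Y B :=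
  { h.toCI.mirror, h with setup := h.setup.mirror }

lemma exists_up_ne_bot (h : BData α Y B) : ∃ τ > (0 : ℝ), B ⊓ h.setup.dyn.up τ ≠ ⊥ := by
  by_contra! h0
  have hα := h.setup.dyn
  have hlo : B ≤ hα.lo 0 := fun b hb => hα.mem_lo_of_forall fun c hc =>
    hα.le_of_split h.toCI (hα.isClosed_lo c) (a := c / 2) (b := c) (by linarith)
      (by rw [h0 (c / 2) (by linarith)]; exact bot_le) inf_le_right hb
  have hup : B ≤ hα.up 0 := fun b hb => hα.mem_up_zero (hlo (h.star_mem b hb))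
  obtain ⟨b₁, hb₁, hb0⟩ := B.ne_bot_iff.1 h.ne
  by_cases hBX : ∀ b ∈ B, ∀ x, b * x ∈ hα.up 0
  · have := h.setup.eq_bot_of_left_ideal' (N := leftHull B) (CI.leftHull hα h.inv)
      (fun x n hn => leftHull_mul_mem x hn)
      (leftHull_le h.setup.closed fun x s hs => h.setup.mulL x s (h.le hs))
      (leftHull_le (hα.isClosed_lo 0) fun x s hs => hα.mem_lo_zero (by
        rw [star_mul]
        exact hBX _ (h.star_mem s hs) _))
    have h1 := subset_leftHull (B : Set X) hb₁
    rw [this] at h1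
    exact hb0 h1
  · push Not at hBX
    obtain ⟨b, hb, x, hx⟩ := hBX
    have hX := fun y k hk => h.setup.mul_mem_upHull (S := B) hx
      (fun s hs => subset_upHull hα (h.her b hb x s hs))
      (fun a ha s hs => subset_upHull hα (by
        have := h.her b hb (x * a) s hs
        rwa [mul_assoc, mul_assoc, ← mul_assoc] at this)) y (k := k) hk
    have := h.setup.eq_bot_of_left_ideal (N := upHull hα B) (CI.upHull hα h.inv) hX
      (upHull_le hα h.setup.closed h.le fun a _ s hs => h.setup.mulL _ _ (h.le hs))
      (upHull_le hα (hα.isClosed_up 0) hup fun a ha s hs =>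
        hα.mul_mem_up' ha (hup hs) (by simp))
    have h1 := subset_upHull hα (S := (B : Set X)) hb₁
    rw [this] at h1
    exact hb0 h1

lemma le_leftHull_up (h : BData α Y B) (γ : ℝ) :
    B ≤ leftHull (B ⊓ h.setup.dyn.up γ : Submodule ℂ X) := by
  have hα := h.setup.dyn
  obtain ⟨τ, hτ, hne⟩ := h.exists_up_ne_bot
  obtain ⟨q₀, hq₀, hq0⟩ := (Submodule.ne_bot_iff _).1 hne
  have hci : ∀ c, CI α (B ⊓ hα.up c) := fun c => h.toCI.inf (CI.up hα c)
  have step : ∀ γ, leftHull ((B ⊓ hα.up (γ - τ) : Submodule ℂ X) : Set X) ≤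
      leftHull ((B ⊓ hα.up γ : Submodule ℂ X) : Set X) := by
    intro γ
    set L := leftHull ((B ⊓ hα.up γ : Submodule ℂ X) : Set X) with hL
    set S : Set X := ((B ⊓ hα.up (γ - τ) : Submodule ℂ X) : Set X) ∪ L with hS
    have hLS : ∀ {x}, x ∈ L → x ∈ upHull hα S := fun hx => subset_upHull hα (Or.inr hx)
    have m1 : ∀ b ∈ B ⊓ hα.up τ, ∀ s ∈ S, b * s ∈ L := by
      rintro b hb s (hs | hs)
      · exact subset_leftHull _ ⟨h.mul_mem b hb.1 s hs.1, hα.mul_mem_up' hb.2 hs.2 (by linarith)⟩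
      · exact leftHull_mul_mem _ hs
    have m2 : ∀ b ∈ B ⊓ hα.up τ, ∀ a ∈ hα.up 0, ∀ s ∈ S, b * (a * s) ∈ L := by
      rintro b hb a ha s (hs | hs)
      · refine subset_leftHull _ ⟨?_, ?_⟩
        · rw [← mul_assoc]; exact h.her b hb.1 a s hs.1
        · exact hα.mul_mem_up' (b := γ - τ) hb.2 (hα.mul_mem_up' ha hs.2 (by linarith))
            (by linarith)
      · exact leftHull_mul_mem _ (leftHull_mul_mem _ hs)
    by_cases hXB : ∀ x, ∀ b ∈ B ⊓ hα.up τ, x * b ∈ hα.up 0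
    · have := h.setup.eq_bot_of_left_ideal (N := leftHull (B ⊓ hα.up τ : Submodule ℂ X))
        (CI.leftHull hα (hci τ).inv) (fun x n hn => leftHull_mul_mem x hn)
        (leftHull_le h.setup.closed fun x s hs => h.setup.mulL x s (h.le hs.1))
        (leftHull_le (hα.isClosed_up 0) hXB)
      have h1 := subset_leftHull _ hq₀
      rw [this] at h1
      exact absurd h1 hq0
    · push Not at hXB
      obtain ⟨x₀, b₀, hb₀, hx₀⟩ := hXB
      have hX := fun y k hk => h.setup.mul_mem_upHull (S := S) hx₀
        (fun s hs => hLS (by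
          rw [mul_assoc]; exact leftHull_mul_mem _ (m1 b₀ hb₀ s hs)))
        (fun a ha s hs => hLS (by
          rw [mul_assoc]; exact leftHull_mul_mem _ (m2 b₀ hb₀ a ha s hs))) y (k := k) hk
      refine leftHull_le_leftHull ?_
      refine h.setup.le_of_mul_mul_mem (CI.leftHull hα (hci γ).inv)
        (fun x l hl => leftHull_mul_mem x hl) (Q := (B ⊓ hα.up τ : Submodule ℂ X)) (hci _).inv
        (fun x hx => h.le hx.1) (fun x hx => h.le hx.1) hq₀ hq0 ?_
      intro q hq x z hz
      rw [mul_assoc]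
      exact mul_mem_of_upHull hα (isClosed_cspan _) (m1 q hq) (m2 q hq)
        (hX x z (subset_upHull hα (Or.inl hz)))
  have iter : ∀ n : ℕ, leftHull ((B ⊓ hα.up (γ - n * τ) : Submodule ℂ X) : Set X) ≤
      leftHull ((B ⊓ hα.up γ : Submodule ℂ X) : Set X) := by
    intro n
    induction n with
    | zero => simp
    | succ n ih =>
      refine le_trans ?_ ih
      have := step (γ - n * τ)
      rwa [sub_sub, ← add_one_mul, ← Nat.cast_succ] at this
  refine hα.le_of_inf_up h.toCI (isClosed_cspan _) fun a => ?_
  obtain ⟨n, hn⟩ := exists_nat_gt ((γ - a) / τ)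
  rw [div_lt_iff₀ hτ] at hn
  intro x hx
  exact iter n (subset_leftHull _ ⟨hx.1, hα.up_anti (by linarith) hx.2⟩)

lemma le_leftHull_lo (h : BData α Y B) (γ : ℝ) :
    B ≤ leftHull (B ⊓ h.setup.dyn.lo γ : Submodule ℂ X) := by
  have := h.mirror.le_leftHull_up (-γ)
  rwa [h.setup.dyn.mirror_up, neg_neg] at this

end BData

end

section

namespace BData

variable {α : ℝ → X → X} {Y B : Submodule ℂ X}

lemma eq_zero_of_band (h : BData α Y B) {w : ℝ} (hw : 0 < w)
    (h0 : B ⊓ (h.setup.dyn.up (-w) ⊓ h.setup.dyn.lo w) = ⊥) : False := by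
  have hα := h.setup.dyn
  refine h.ne (le_bot_iff.1 (hα.le_of_bands h.toCI (CI.bot hα).closed hw fun c b hb => ?_))
  obtain ⟨hb, hb1, hb2⟩ := hb
  have : star b * b ∈ B ⊓ (h.setup.dyn.up (-w) ⊓ h.setup.dyn.lo w) :=
    ⟨h.mul_mem _ (h.star_mem b hb) b hb, hα.mul_mem_up' (hα.star_mem_up hb2) hb1 (by linarith),
      hα.mul_mem_lo' (hα.star_mem_lo hb1) hb2 (by linarith)⟩
  rw [h0, Submodule.mem_bot, CStarRing.star_mul_self_eq_zero_iff] at this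
  exact this

lemma exists_mul_notMem (h : BData α Y B) {k δ : ℝ} (hδ : 0 < δ) (hk : δ ≤ k) {y : X}
    (hy : y ∈ h.setup.dyn.up (-k)) (hy0 : y ∉ h.setup.dyn.up 0) :
    ∃ z ∈ h.setup.dyn.up (-k), ∃ b ∈ B ⊓ (h.setup.dyn.up (-δ) ⊓ h.setup.dyn.lo δ),
      z * b ∉ h.setup.dyn.up 0 := by
  by_contra! H
  have hα := h.setup.dyn
  set S : Submodule ℂ X := B ⊓ (hα.up (-(δ / 2)) ⊓ hα.lo (δ / 2)) with hS
  have hSCI : CI α S := h.toCI.inf ((CI.up hα _).inf (CI.lo hα _))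
  have hstar : ∀ s ∈ S, star s ∈ S := fun s hs =>
    ⟨h.star_mem s hs.1, hα.star_mem_up hs.2.2, by simpa using hα.star_mem_lo hs.2.1⟩
  have hmul : ∀ s ∈ S, ∀ t ∈ S, s * t ∈ B ⊓ (hα.up (-δ) ⊓ hα.lo δ) := fun s hs t ht =>
    ⟨h.mul_mem s hs.1 t ht.1, hα.mul_mem_up' hs.2.1 ht.2.1 (by linarith),
      hα.mul_mem_lo' hs.2.2 ht.2.2 (by linarith)⟩
  have hSδ : ∀ s ∈ S, s ∈ B ⊓ (hα.up (-δ) ⊓ hα.lo δ) := fun s hs =>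
    ⟨hs.1, hα.up_anti (by linarith) hs.2.1, hα.lo_mono (by linarith) hs.2.2⟩
  have h0k : hα.up 0 ≤ hα.up (-k) := hα.up_anti (by linarith)
  have hSA : S ≤ hα.up 0 := fun s hs => by
    refine mem_of_mul_star_mul (hα.isClosed_up 0) ?_ fun n hn =>
      H n (h0k hn) _ (hmul _ (hstar s hs) s hs)
    rw [← mul_assoc]
    exact H _ (hα.up_anti (by linarith) (hmul _ hs _ (hstar s hs)).2.1) s (hSδ s hs)
  have hup : ∀ a ∈ hα.up 0, ∀ s ∈ S, a * s ∈ upHull hα (S : Set X) := fun a ha s hs =>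
    upHull_mul_mem hα ha (subset_upHull hα hs)
  have hKR : ∀ b ∈ S, ∀ n ∈ upHull hα (S : Set X), n * (star b * b) ∈ upHull hα (S : Set X) := by
    intro b hb n hn
    refine mul_mem_of_cspan' (isClosed_cspan _) ?_ hn
    rintro s (hs | ⟨a, ha, s, hs, rfl⟩)
    · rw [← mul_assoc]
      exact hup _ (hα.mul_mem_up' (hSA hs) (hSA (hstar b hb)) (by simp)) b hb
    · rw [← mul_assoc]
      exact hup _ (hα.mul_mem_up' (hα.mul_mem_up' (c := 0) ha (hSA hs) (by simp))
        (hSA (hstar b hb)) (by simp)) b hb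
  have hyS : ∀ z ∈ hα.up (-k), ∀ s ∈ S, z * s ∈ upHull hα (S : Set X) := fun z hz s hs => by
    refine mem_of_mul_star_mul (isClosed_mulInto (isClosed_cspan _) z) (b := s) ?_ fun n hn => ?_
    · change z * (s * (star s * s)) ∈ upHull hα (S : Set X)
      rw [← mul_assoc s, ← mul_assoc z]
      exact hup _ (H z hz _ (hmul s hs _ (hstar s hs))) s hs
    · change z * (n * (star s * s)) ∈ upHull hα (S : Set X)
      rw [← mul_assoc]
      exact hKR s hs _ hn
  have hX := fun x n hn => h.setup.mul_mem_upHull (S := S) hy0 (hyS y hy)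
    (fun a ha s hs => by
      rw [← mul_assoc]
      exact hyS _ (hα.mul_mem_up' hy ha (by simp)) s hs) x (k := n) hn
  have hK := h.setup.eq_bot_of_left_ideal (CI.upHull hα hSCI.inv) hX
    (upHull_le hα h.setup.closed (fun s hs => h.le hs.1) fun a _ s hs => h.setup.mulL a s (h.le hs.1))
    (upHull_le hα (hα.isClosed_up 0) hSA fun a ha s hs => hα.mul_mem_up' ha (hSA hs) (by simp))
  refine h.eq_zero_of_band (half_pos hδ) (Submodule.eq_bot_iff _ |>.2 fun s hs => ?_)
  have := subset_upHull hα (S := (S : Set X)) hs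
  rw [hK] at this
  exact this

lemma exists_mul_notMem' (h : BData α Y B) {ε : ℝ} (hε : 0 < ε) :
    ∃ b ∈ B ⊓ h.setup.dyn.up (-ε), ∃ z ∈ h.setup.dyn.up (-ε), b * z ∉ h.setup.dyn.up 0 := by
  have hα := h.setup.dyn
  obtain ⟨j, k, hj, -, hk, x, hx, hx0⟩ := h.setup.acc ε hε
  obtain ⟨z, hz, b, hb, hzb⟩ := h.mirror.exists_mul_notMem hε le_rfl (y := x)
    (by rw [hα.mirror_up, neg_neg]; exact hα.lo_mono hk.le hx.2) (fun h' => hx0 <| by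
      rw [hα.mirror_up, neg_zero] at h'
      exact hα.eq_zero_of_up_of_lo hj hx.1 h')
  rw [hα.mirror_up, neg_neg] at hz hb
  rw [hα.mirror_up, neg_zero] at hzb
  refine ⟨star b, ⟨h.star_mem b hb.1, hα.star_mem_up hb.2.1⟩, star z, hα.star_mem_up hz,
    fun h' => hzb (hα.mem_lo_zero ?_)⟩
  rwa [star_mul]

/-- The spectral part of `B` in the band of radius `ε` around `γ`. -/
def band (h : BData α Y B) (γ ε : ℝ) : Submodule ℂ X :=
  B ⊓ (h.setup.dyn.up (γ - ε) ⊓ h.setup.dyn.lo (γ + ε))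

lemma le_upHull (h : BData α Y B) (γ : ℝ) {ε : ℝ} (hε : 0 < ε) :
    B ≤ upHull h.setup.dyn
      ((B ⊓ h.setup.dyn.up γ : Submodule ℂ X) ∪ leftHull (h.band γ ε : Set X)) := by
  have hα := h.setup.dyn
  set S : Set X := (B ⊓ hα.up γ : Submodule ℂ X) ∪ leftHull (h.band γ ε : Set X) with hS
  have hL : ∀ {x}, x ∈ leftHull (h.band γ ε : Set X) → x ∈ upHull hα S := fun hx =>
    subset_upHull hα (Or.inr hx)
  have hK : IsClosed (upHull hα S : Set X) := isClosed_cspan _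
  have hB : B ⊓ hα.up (γ - ε) ≤ upHull hα S :=
    hα.le_of_split (h.toCI.inf (CI.up hα _)) hK (a := γ) (b := γ + ε) (by linarith)
      (fun x hx => subset_upHull hα (Or.inl ⟨hx.1.1, hx.2⟩))
      (fun x hx => hL (subset_leftHull _ ⟨hx.1.1, hx.1.2, hx.2⟩))
  obtain ⟨b, hb, z, hz, hbz⟩ := h.exists_mul_notMem' (half_pos hε)
  have hX := fun y k hk => h.setup.mul_mem_upHull (S := S) hbz
    (by
      rintro s (hs | hs)
      · exact hB ⟨h.her b hb.1 z s hs.1, hα.mul_mem_up' (hα.mul_mem_up hb.2 hz) hs.2 (by linarith)⟩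
      · exact hL (leftHull_mul_mem _ hs))
    (by
      rintro a ha s (hs | hs)
      · refine hB ⟨?_, ?_⟩
        · have := h.her b hb.1 (z * a) s hs.1
          simpa only [mul_assoc, SetLike.mem_coe] using this
        · exact hα.mul_mem_up' (hα.mul_mem_up hb.2 hz) (hα.mul_mem_up ha hs.2) (by linarith)
      · exact hL (leftHull_mul_mem _ (leftHull_mul_mem _ hs))) y (k := k) hk
  exact (h.le_leftHull_up γ).trans
    (leftHull_le hK fun x s hs => hX x s (subset_upHull hα (Or.inl hs)))

lemma band_ci (h : BData α Y B) (γ ε : ℝ) : CI α (h.band γ ε) :=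
  h.toCI.inf ((CI.up h.setup.dyn _).inf (CI.lo h.setup.dyn _))

/-- The closed left ideal of `B` generated by a band. -/
def bandIdeal (h : BData α Y B) (γ ε : ℝ) : Submodule ℂ X :=
  cspan {z | ∃ b ∈ B, ∃ v ∈ h.band γ ε, z = b * v}

lemma bandIdeal_ci (h : BData α Y B) (γ ε : ℝ) : CI α (h.bandIdeal γ ε) := by
  refine CI.cspan h.setup.dyn ?_
  rintro t _ ⟨b, hb, v, hv, rfl⟩
  exact ⟨_, h.inv t b hb, _, (h.band_ci γ ε).inv t v hv, h.setup.dyn.map_mul _ _ _⟩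

lemma mul_mul_mem_bandIdeal (h : BData α Y B) {γ ε : ℝ} {b : X} (hb : b ∈ B) (x : X) {t : X}
    (ht : t ∈ h.bandIdeal γ ε) : b * x * t ∈ h.bandIdeal γ ε := by
  refine mul_mem_of_cspan (isClosed_cspan _) ?_ ht
  rintro _ ⟨c, hc, v, hv, rfl⟩
  rw [← mul_assoc]
  exact subset_cspan _ ⟨_, h.her b hb x c hc, v, hv, rfl⟩

lemma mul_mem_bandIdeal (h : BData α Y B) {γ ε : ℝ} {b : X} (hb : b ∈ B) {t : X}
    (ht : t ∈ h.bandIdeal γ ε) : b * t ∈ h.bandIdeal γ ε := by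
  refine mul_mem_of_cspan (isClosed_cspan _) ?_ ht
  rintro _ ⟨c, hc, v, hv, rfl⟩
  rw [← mul_assoc]
  exact subset_cspan _ ⟨_, h.mul_mem b hb c hc, v, hv, rfl⟩

lemma mem_bandIdeal_of_mul (h : BData α Y B) {γ ε : ℝ} {b : X} (hb : b ∈ B)
    (hb' : b * star b * b ∈ h.bandIdeal γ ε) : b ∈ h.bandIdeal γ ε :=
  mem_of_mul_star_mul' (isClosed_cspan _) hb' fun _ hn =>
    h.mul_mem_bandIdeal (h.mul_mem b hb _ (h.star_mem b hb)) hn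

lemma mul_mem_bandIdeal_of_leftHull (h : BData α Y B) {γ ε : ℝ} {S : Set X}
    (hS : S ⊆ h.bandIdeal γ ε) {b x : X} (hb : b ∈ B) (hx : x ∈ leftHull S) :
    b * x ∈ h.bandIdeal γ ε := by
  refine mul_mem_of_cspan (isClosed_cspan _) ?_ hx
  rintro _ ⟨y, s, hs, rfl⟩
  rw [← mul_assoc]
  exact h.mul_mul_mem_bandIdeal hb y (hS hs)

lemma band_le_bandIdeal (h : BData α Y B) (γ ε : ℝ) : h.band γ ε ≤ h.bandIdeal γ ε := fun v hv =>
  h.mem_bandIdeal_of_mul hv.1 (subset_cspan _ ⟨_, h.mul_mem v hv.1 _ (h.star_mem v hv.1), v, hv, rfl⟩)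

lemma le_bandIdeal (h : BData α Y B) (γ : ℝ) {ε : ℝ} (hε : 0 < ε) : B ≤ h.bandIdeal γ ε := by
  have hα := h.setup.dyn
  set T := h.bandIdeal γ ε with hT
  have hc : IsClosed ((T ⊔ hα.up (γ - 1)).topologicalClosure : Set X) :=
    Submodule.isClosed_topologicalClosure _
  have hle := Submodule.le_topologicalClosure (T ⊔ hα.up (γ - 1))
  have hmul : ∀ b ∈ B ⊓ hα.up (-1), ∀ c ∈ B, b * c ∈ (T ⊔ hα.up (γ - 1)).topologicalClosure := by
    intro b hb c hcB
    have hbL : ∀ {x}, x ∈ leftHull (h.band γ ε : Set X) →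
        b * x ∈ (T ⊔ hα.up (γ - 1)).topologicalClosure := fun hx =>
      hle (le_sup_left (a := T) (h.mul_mem_bandIdeal_of_leftHull (h.band_le_bandIdeal γ ε) hb.1 hx))
    refine mul_mem_of_upHull hα hc ?_ ?_ (h.le_upHull γ hε hcB)
    · rintro s (hs | hs)
      · exact hle (le_sup_right (a := T) (hα.mul_mem_up' hb.2 hs.2 (by linarith)))
      · exact hbL hs
    · rintro a ha s (hs | hs)
      · exact hle (le_sup_right (a := T)
          (hα.mul_mem_up' hb.2 (hα.mul_mem_up ha hs.2) (by linarith)))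
      · exact hbL (leftHull_mul_mem _ hs)
  have hlow : B ⊓ hα.lo (γ - 3) ≤ T := by
    refine hα.le_of_bands (h.toCI.inf (CI.lo hα _)) (isClosed_cspan _) one_pos ?_
    rintro c s ⟨⟨hs, hs3⟩, hs1, hs2⟩
    have hss : s * star s ∈ B := h.mul_mem s hs _ (h.star_mem s hs)
    refine h.mem_bandIdeal_of_mul hs (hα.mem_of_separated (h.bandIdeal_ci γ ε)
      (a := γ - 2) (b := γ - 1) (by linarith) le_rfl ?_ (hmul _ ⟨hss, ?_⟩ s hs))
    · exact hα.mul_mem_lo' (hα.mul_mem_lo hs2 (hα.star_mem_lo hs1)) hs3 (by linarith)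
    · exact hα.mul_mem_up' hs1 (hα.star_mem_up hs2) (by linarith)
  intro b hb
  exact h.mem_bandIdeal_of_mul hb (h.mul_mem_bandIdeal_of_leftHull hlow
    (h.mul_mem b hb _ (h.star_mem b hb)) (h.le_leftHull_lo _ hb))

lemma cspan_eq (h : BData α Y B) (γ : ℝ) {ε : ℝ} (hε : 0 < ε) :
    cspan (MulSet3 (star '' (h.band γ ε : Set X)) B (h.band γ ε : Set X)) = B := by
  set M := cspan (MulSet3 (star '' (h.band γ ε : Set X)) B (h.band γ ε : Set X)) with hM
  have hMc : IsClosed (M : Set X) := isClosed_cspan _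
  have hMB : M ≤ B := cspan_le h.closed (by
    rintro _ ⟨_, ⟨v, hv, rfl⟩, b, hb, w, hw, rfl⟩
    exact h.mul_mem _ (h.mul_mem _ (h.star_mem v hv.1) b hb) w hw.1)
  have h1 : ∀ v ∈ h.band γ ε, ∀ b ∈ B, ∀ c ∈ B, star v * b * c ∈ M := fun v hv b hb c hc => by
    refine mul_mem_of_cspan hMc ?_ (h.le_bandIdeal γ hε hc)
    rintro _ ⟨d, hd, w, hw, rfl⟩
    refine subset_cspan _ ⟨star v, ⟨v, hv, rfl⟩, b * d, h.mul_mem b hb d hd, w, hw, ?_⟩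
    simp only [mul_assoc]
  have h2 : ∀ b ∈ B, ∀ c ∈ B, b * c ∈ M := fun b hb c hc => by
    have : star b ∈ stars (mulInto' M c) := by
      refine cspan_le (isClosed_stars (isClosed_mulInto' hMc c)) ?_
        (h.le_bandIdeal γ hε (h.star_mem b hb))
      rintro _ ⟨d, hd, v, hv, rfl⟩
      change star (d * v) * c ∈ M
      rw [star_mul]
      exact h1 v hv _ (h.star_mem d hd) c hc
    rw [mem_stars, star_star] at this
    exact this
  refine le_antisymm hMB fun b hb => ?_
  have hbb := h.mul_mem b hb _ (h.star_mem b hb)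
  exact mem_of_mul_star_mul' hMc (h2 _ hbb b hb) fun n hn => h2 _ hbb n (hMB hn)

lemma strongSpec_eq (h : BData α Y B) : strongSpec α (B : Set X) = univ := by
  refine eq_univ_of_forall fun γ ε hε => ?_
  have := congrArg (fun N : Submodule ℂ X => (N : Set X)) (h.cspan_eq γ hε)
  rwa [show (h.band γ ε : Set X) = (B : Set X) ∩ specC α (Icc (γ - ε) (γ + ε)) by
    rw [h.setup.dyn.specC_Icc]; rfl] at this

lemma actSpec_eq (h : BData α Y B) : actSpec α (B : Set X) = univ := by
  refine eq_univ_of_forall fun γ ε hε e => h.ne ?_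
  have e' : (h.band γ ε : Set X) = {0} := by
    rw [← e, h.setup.dyn.specC_Icc]; rfl
  rw [← h.cspan_eq γ hε, e', ← le_bot_iff]
  refine cspan_le (CI.bot h.setup.dyn).closed ?_
  rintro _ ⟨v, -, b, -, w, rfl, rfl⟩
  simp

end BData

end

section

variable {α : ℝ → X → X}

lemma exists_pos_cutoff {K : Set ℝ} (hK : IsCompact K) (hpos : K ⊆ Ioi 0) :
    ∃ c > (0 : ℝ), ∃ g, Nice g ∧ (∀ ξ < c, g ξ = 0) ∧ ∀ ξ ∈ K, g ξ = 1 := by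
  obtain ⟨R, hR, hKR⟩ := hK.isBounded.exists_pos_norm_le
  have h0 : (0 : ℝ) ∈ Kᶜ := fun h => lt_irrefl (0 : ℝ) (hpos h)
  obtain ⟨r, hr, hb⟩ := Metric.isOpen_iff.1 hK.isClosed.isOpen_compl 0 h0
  obtain ⟨g, hg, hg1, -⟩ := exists_bump
  obtain ⟨χ, hχ, hχ0, hχ1⟩ := exists_step (half_lt_self hr)
  refine ⟨r / 2, half_pos hr, _, (hg.comp_div hR 0).mul_right hχ, fun ξ hξ => ?_, fun ξ hξ => ?_⟩
  · rw [hχ0 ξ hξ.le, mul_zero]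
  · have hp : 0 < ξ := hpos hξ
    rw [hχ1 ξ, mul_one, hg1]
    · rw [sub_zero, abs_div, abs_of_pos hR, div_le_one hR]
      exact hKR ξ hξ
    · by_contra! hlt
      refine hb ?_ hξ
      rw [Metric.mem_ball, dist_zero_right, Real.norm_eq_abs, abs_of_pos hp]
      exact hlt

lemma IsCStarDynSys.smear_mult_eq (hα : IsCStarDynSys α) {f g : ℝ → ℂ} (hf : Integrable f)
    (hg : Nice g) (h : ∀ ξ ∈ tsupport (fourierT f), g ξ = 1) (x : X) :
    smear α f (mult α g x) = smear α f x := by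
  rw [← sub_eq_zero]
  refine hα.eq_zero_of_mult fun u hu => ?_
  have e1 : mult α u (smear α f (mult α g x) - smear α f x) =
      smear α f (mult α u (mult α g x)) - smear α f (mult α u x) := by
    rw [hα.smear_mult_comm hf hu, hα.smear_mult_comm hf hu]
    exact (hα.smearL hu.integrable_kern).map_sub _ _
  rw [e1, hα.mult_mult hg hu, sub_eq_zero, hα.smear_mult hf hu,
    hα.smear_mult hf (hg.mul_right hu.smooth)]
  congr 2
  funext ξ
  by_cases hξ : ξ ∈ tsupport (fourierT f)
  · rw [h ξ hξ, one_mul]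
  · rw [image_eq_zero_of_notMem_tsupport hξ, mul_zero, mul_zero]

lemma specO_Ioi_eq (hα : IsCStarDynSys α) {Y : Submodule ℂ X} (hY : ∀ c > (0 : ℝ), hα.up c ≤ Y) :
    specO α (Y : Set X) (Ioi 0) = specO α univ (Ioi 0) := by
  unfold specO
  congr 1
  ext y
  constructor
  · rintro ⟨x, -, h⟩
    exact ⟨x, trivial, h⟩
  · rintro ⟨x, -, f, hf, hc, hs, rfl⟩
    obtain ⟨c, hc0, g, hg, hg0, hg1⟩ := exists_pos_cutoff hc hs
    exact ⟨mult α g x, hY c hc0 (hα.mult_mem_up hg hg0 x), f, hf, hc, hs,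
      (hα.smear_mult_eq hf hg hg1 x).symm⟩

/-- A set closed under the vector space operations, as a submodule. -/
def toSubmodule {K : Set X} (h0 : (0 : X) ∈ K) (ha : ∀ x ∈ K, ∀ y ∈ K, x + y ∈ K)
    (hs : ∀ c : ℂ, ∀ x ∈ K, c • x ∈ K) : Submodule ℂ X where
  carrier := K
  zero_mem' := h0
  add_mem' hx hy := ha _ hx _ hy
  smul_mem' c _ hx := hs c _ hx

lemma CIdeal.of_ideal {Y K : Submodule ℂ X} (hY : CIdeal α Y) (hK : CI α K) (hKY : K ≤ Y)
    (h : ∀ s ∈ Y, ∀ k ∈ K, s * k ∈ K ∧ k * s ∈ K) : CIdeal α K :=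
  { hK with
    mulL := fun x k hk => by
      have hs := hY.star_mem (hKY hk)
      refine mem_of_mul_star_mul (isClosed_mulInto hK.closed x) (b := k) ?_ fun n hn => ?_
      · change x * (k * (star k * k)) ∈ K
        rw [← mul_assoc, ← mul_assoc]
        exact (h _ (hY.mulR _ _ (hY.mulL x k (hKY hk))) k hk).1
      · change x * (n * (star k * k)) ∈ K
        rw [← mul_assoc]
        exact (h _ (hY.mulR _ _ hs) _ hn).2
    mulR := fun x k hk => by
      have hs := hY.star_mem (hKY hk)
      refine mem_of_mul_star_mul' (isClosed_mulInto' hK.closed x) (b := k) ?_ fun n hn => ?_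
      · change k * star k * k * x ∈ K
        rw [mul_assoc, mul_assoc]
        exact (h _ (hY.mulR _ _ hs) k hk).2
      · change k * star k * n * x ∈ K
        rw [mul_assoc]
        exact (h _ (hY.mulL _ _ hs) _ hn).1 }

lemma Setup.alphaSimple {Y : Submodule ℂ X} (h : Setup α Y) : AlphaSimple α (Y : Set X) := by
  rintro K ⟨hKY, hKc, h0, ha, hs, hm⟩ hinv
  let K' := toSubmodule h0 ha hs
  have hK' : CI α K' := ⟨hKc, hinv⟩
  rcases h.simple K' (h.toCIdeal.of_ideal hK' hKY hm) with e | e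
  · left
    rw [inf_eq_right.2 (show K' ≤ Y from hKY)] at e
    exact congrArg (fun N : Submodule ℂ X => (N : Set X)) e
  · exact Or.inr (hKY.antisymm e)

lemma star_mul_mul_mem_of_nonneg {Y B : Submodule ℂ X} (hL : ∀ x, ∀ y ∈ Y, x * y ∈ Y) (hBY : B ≤ Y)
    (hmul : ∀ b ∈ B, ∀ c ∈ B, b * c ∈ B) (hstar : ∀ b ∈ B, star b ∈ B)
    (hher : ∀ x ∈ Y, ∀ b ∈ B, 0 ≤ x → x ≤ b → x ∈ B) {b x : X} (hb : b ∈ B) (hx : 0 ≤ x) :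
    star b * x * b ∈ B := by
  let _ : NonUnitalCStarAlgebra X := { }
  refine hher _ (hL _ _ (hBY hb)) ((‖x‖ : ℂ) • (star b * b))
    (B.smul_mem _ (hmul _ (hstar b hb) b hb)) (star_left_conjugate_nonneg hx b) ?_
  have := CStarAlgebra.star_left_conjugate_le_norm_smul (a := b) (b := x) (hb := hx.isSelfAdjoint)
  rwa [← Complex.coe_smul] at this

lemma mul_mul_mem_of_hereditary {Y B : Submodule ℂ X} (hL : ∀ x, ∀ y ∈ Y, x * y ∈ Y) (hBY : B ≤ Y)
    (hmul : ∀ b ∈ B, ∀ c ∈ B, b * c ∈ B) (hstar : ∀ b ∈ B, star b ∈ B)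
    (hher : ∀ x ∈ Y, ∀ b ∈ B, 0 ≤ x → x ≤ b → x ∈ B) {b c : X} (hb : b ∈ B) (x : X) (hc : c ∈ B) :
    b * x * c ∈ B := by
  let _ : NonUnitalCStarAlgebra X := { }
  have h1 : ∀ b ∈ B, ∀ x, star b * x * b ∈ B := fun b hb x => by
    have hx : x ∈ Submodule.span ℂ {a : X | 0 ≤ a} := by rw [CStarAlgebra.span_nonneg]; trivial
    induction hx using Submodule.span_induction with
    | mem x hx => exact star_mul_mul_mem_of_nonneg hL hBY hmul hstar hher hb hx
    | zero => simp
    | add x y _ _ hx hy => rw [mul_add, add_mul]; exact B.add_mem hx hy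
    | smul c x _ hx => rw [mul_smul_comm, smul_mul_assoc]; exact B.smul_mem c hx
  have h2 : ∀ b ∈ B, ∀ c ∈ B, star b * x * c + star c * x * b ∈ B := fun b hb c hc => by
    have := B.sub_mem (B.sub_mem (h1 _ (B.add_mem hb hc) x) (h1 b hb x)) (h1 c hc x)
    convert this using 1
    rw [star_add]
    noncomm_ring
  have h3 : ∀ b ∈ B, ∀ c ∈ B, star b * x * c ∈ B := fun b hb c hc => by
    have e1 := h2 b hb c hc
    have e2 := B.smul_mem (-Complex.I) (h2 b hb _ (B.smul_mem Complex.I hc))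
    have e3 := B.smul_mem (1 / 2 : ℂ) (B.add_mem e1 e2)
    convert e3 using 1
    rw [star_smul, mul_smul_comm, smul_mul_assoc, smul_mul_assoc, Complex.star_def, Complex.conj_I]
    match_scalars <;> ring_nf <;> simp [Complex.I_sq]
    norm_num
  simpa using h3 _ (hstar b hb) c hc

lemma Setup.strongSpec_eq {Y : Submodule ℂ X} (h : Setup α Y) {B : Set X}
    (hB : IsHereditaryIn (Y : Set X) B) (hne : B ≠ {0}) (hinv : Invariant α B) :
    strongSpec α B = univ := by
  obtain ⟨hBY, hc, ⟨⟨h0, ha, hs, hm⟩, hst⟩, hh⟩ := hB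
  have : BData α Y (toSubmodule h0 ha hs) :=
    { closed := hc
      inv := hinv
      setup := h
      mul_mem := hm
      star_mem := hst
      her := fun b hb x c hc => mul_mul_mem_of_hereditary h.mulL hBY hm hst hh hb x hc
      le := hBY
      ne := fun e => hne (congrArg (fun N : Submodule ℂ X => (N : Set X)) e) }
  exact this.strongSpec_eq

lemma Setup.bData {Y : Submodule ℂ X} (h : Setup α Y) : BData α Y Y :=
  { h.toCI with
    setup := h
    mul_mem := fun b _ c hc => h.mulL b c hc
    star_mem := fun b hb => h.toCIdeal.star_mem hb
    her := fun b _ x c hc => h.mulL _ c hc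
    le := le_rfl
    ne := fun e => by
      obtain ⟨j, k, hj, -, -, x, hx, hx0⟩ := h.acc 1 one_pos
      have := h.up_le j hj hx.1
      rw [e] at this
      exact hx0 this }

lemma Setup.connesSpec_eq {Y : Submodule ℂ X} (h : Setup α Y) : ConnesSpec α (Y : Set X) = univ := by
  refine eq_univ_of_forall fun γ => mem_iInter₂.2 fun B hB => ?_
  rw [h.strongSpec_eq hB.1 hB.2.1 hB.2.2]
  trivial

lemma maxSub_up (hα : IsCStarDynSys α) (hmax : IsMaximalClosedSubalgebra (specC α (Ici (0 : ℝ)))) :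
    MaxSub (hα.up 0) := by
  intro W hW hm hle
  rw [hα.specC_Ici] at hmax
  rcases hmax.2.2.2 W hW ⟨W.zero_mem, fun x hx y hy => W.add_mem hx hy,
    fun c x hx => W.smul_mem c hx, hm⟩ hle with e | e
  · exact Or.inl (SetLike.coe_injective e)
  · exact Or.inr (SetLike.coe_injective (by rw [e]; rfl))

lemma exists_band_ne_zero (hα : IsCStarDynSys α)
    (hacc : ∀ ε > (0 : ℝ), ∃ γ ∈ actSpec α (univ : Set X), γ ≠ 0 ∧ |γ| < ε) {ε : ℝ} (hε : 0 < ε) :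
    ∃ j k : ℝ, 0 < j ∧ j ≤ k ∧ k < ε ∧ ∃ x ∈ hα.up j ⊓ hα.lo k, x ≠ 0 := by
  obtain ⟨γ, hγ, h0, hlt⟩ := hacc (ε / 2) (half_pos hε)
  have hpos := abs_pos.2 h0
  have h1 := hγ (|γ| / 2) (half_pos hpos)
  rw [hα.specC_Icc, univ_inter] at h1
  have hne : hα.up (γ - |γ| / 2) ⊓ hα.lo (γ + |γ| / 2) ≠ ⊥ := fun e => h1 (by rw [e]; rfl)
  obtain ⟨x, hx, hx0⟩ := (Submodule.ne_bot_iff _).1 hne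
  refine ⟨|γ| / 2, 3 * |γ| / 2, by linarith, by linarith, by linarith, ?_⟩
  rcases abs_cases γ with ⟨e, -⟩ | ⟨e, -⟩
  · exact ⟨x, ⟨hα.up_anti (by linarith) hx.1, hα.lo_mono (by linarith) hx.2⟩, hx0⟩
  · exact ⟨star x, ⟨hα.up_anti (by linarith) (hα.star_mem_up hx.2),
      hα.lo_mono (by linarith) (hα.star_mem_lo hx.1)⟩, by simpa using hx0⟩

end

/-- **Lemma 4.16.** If `0` is an accumulation point of `sp(α)` and `X^α([0,∞))` is a maximal
norm-closed subalgebra of `X`, then Condition 4.3 b) holds. -/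
theorem condition43b_of_maximal_of_accumulation (α : ℝ → X → X) (hα : IsCStarDynSys α)
    (hacc : ∀ ε > (0 : ℝ), ∃ γ ∈ actSpec α (univ : Set X), γ ≠ 0 ∧ |γ| < ε)
    (hmax : IsMaximalClosedSubalgebra (specC α (Ici (0 : ℝ)))) :
    ∃ Y : Set X, IsClosedTwoSidedIdealIn (univ : Set X) Y ∧ Invariant α Y ∧
      AlphaSimple α Y ∧
      specO α Y (Ioi (0 : ℝ)) = specO α (univ : Set X) (Ioi (0 : ℝ)) ∧
      actSpec α Y = ConnesSpec α Y ∧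
      closure (Y + specC α (Ici (0 : ℝ))) = (univ : Set X) := by
  have hM := maxSub_up hα hmax
  have hband := fun ε (hε : ε > 0) => exists_band_ne_zero hα hacc hε
  have hS := setup_posIdeal hα hM hband
  refine ⟨posIdeal hα, ⟨subset_univ _, hS.closed, Submodule.zero_mem _,
    fun x hx y hy => Submodule.add_mem _ hx hy, fun c x hx => Submodule.smul_mem _ c hx,
    fun s _ k hk => ⟨hS.mulL s k hk, hS.mulR s k hk⟩⟩, hS.inv, hS.alphaSimple,
    specO_Ioi_eq hα hS.up_le, ?_, ?_⟩
  · rw [hS.bData.actSpec_eq, hS.connesSpec_eq]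
  · have := congrArg (fun N : Submodule ℂ X => (N : Set X)) (closure_posIdeal hα hM hband)
    rw [hα.specC_Ici, ← Submodule.coe_sup]
    exact this

end PeligradMax
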